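/- arXiv:2409.10051 — 2 statements merged into one kernel-verified Lean document; each statement's English description precedes it below -/
import Mathlib

section
/- Let N ≥ 2 and let 1 ≤ n_1 ≤ n_2 ≤ ⋯ ≤ n_J ≤ N be real numbers, χ(x, λ) = #{j : |x − n_j| ≤ λ}, a_1, …, a_J complex, and S(it) = ∑_{j=1}^J a_j n_j^{−it}. Let T_0 ∈ ℝ, T > 0, δ > 0, and let 𝒯 ⊂ [T_0 + δ/2, T_0 + T − δ/2] be a finite set of δ-well-spaced points (|t − t'| ≥ δ for distinct t, t' ∈ 𝒯). Then there is an absolute constant C such that for every η > 0, ∑_{t∈𝒯} |S(it)|² ≤ C (T + 1/η)(log N + 1/δ) ∑_{j=1}^J χ(n_j, ηN) |a_j|². -/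
open Filter

open MeasureTheory in
/-- The Fourier transform of a shifted Gaussian. -/
lemma norm_integral_gaussian_mul_cexp {b : ℝ} (hb : 0 < b) (c ξ : ℝ) :
    Integrable (fun t : ℝ => (Real.exp (-b * (t - c) ^ 2) : ℂ) * Complex.exp (Complex.I * ξ * t)) ∧
    ‖∫ t : ℝ, (Real.exp (-b * (t - c) ^ 2) : ℂ) * Complex.exp (Complex.I * ξ * t)‖
      = √(Real.pi / b) * Real.exp (-ξ ^ 2 / (4 * b)) := by
  have hfun : (fun t : ℝ => (Real.exp (-b * (t - c) ^ 2) : ℂ) * Complex.exp (Complex.I * ξ * t))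
      = fun t : ℝ => Complex.exp ((-b : ℂ) * (t : ℂ) ^ 2
          + (2 * b * c + Complex.I * ξ) * (t : ℂ) + (-b * c ^ 2)) := by
    funext t
    rw [Complex.ofReal_exp, ← Complex.exp_add]
    congr 1
    push_cast
    ring
  have hre : (-b : ℂ).re < 0 := by simpa using hb
  rw [hfun]
  refine ⟨integrable_cexp_quadratic' hre _ _, ?_⟩
  rw [integral_cexp_quadratic hre, norm_mul, Complex.norm_exp]
  have hexp : ((-b * c ^ 2 : ℂ) - (2 * b * c + Complex.I * ξ) ^ 2 / (4 * (-b : ℂ)))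
      = ((-ξ ^ 2 / (4 * b) : ℝ) : ℂ) + ((c * ξ : ℝ) : ℂ) * Complex.I := by
    have hb' : (b : ℂ) ≠ 0 := by exact_mod_cast hb.ne'
    push_cast
    field_simp
    ring_nf
    simp only [Complex.I_sq]
    ring
  rw [hexp]
  congr 1
  · have h : (Real.pi : ℂ) / - -(b : ℂ) = ((Real.pi / b : ℝ) : ℂ) := by push_cast; ring
    rw [h, Complex.norm_cpow_eq_rpow_re_of_pos (by positivity), Real.sqrt_eq_rpow]
    norm_num
  · simp [-Complex.ofReal_div]

open MeasureTheory in
/-- Mean square of an exponential sum over an interval of length `T`, by comparison with a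
Gaussian of width `R ≥ T`. -/
lemma setIntegral_norm_sq_exponential_sum_le {ι : Type*} [Fintype ι] (lam : ι → ℝ) (a : ι → ℂ)
    {c T R : ℝ} (hR : 0 < R) (hTR : T ≤ R) :
    ∫ t in Set.Ioc c (c + T), ‖∑ j, a j * Complex.exp (lam j * -(Complex.I * t))‖ ^ 2
      ≤ Real.exp 1 * √Real.pi * R *
        ∑ i, ∑ j, ‖a i‖ * ‖a j‖ * Real.exp (-(R * (lam i - lam j)) ^ 2 / 4) := by
  set S : ℝ → ℂ := fun t => ∑ j, a j * Complex.exp (lam j * -(Complex.I * t)) with hS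
  set b : ℝ := 1 / R ^ 2 with hb
  have hb0 : 0 < b := by positivity
  have hScont : Continuous S := by fun_prop
  have hexpand (t : ℝ) : ((Real.exp (-b * (t - c) ^ 2) * ‖S t‖ ^ 2 : ℝ) : ℂ)
      = ∑ i, ∑ j, a i * (starRingEnd ℂ) (a j) * ((Real.exp (-b * (t - c) ^ 2) : ℂ) *
          Complex.exp (Complex.I * (lam j - lam i : ℝ) * t)) := by
    rw [Complex.ofReal_mul, Complex.ofReal_pow, ← Complex.mul_conj', hS, map_sum,
      Finset.sum_mul_sum, Finset.mul_sum]
    refine Finset.sum_congr rfl fun i _ => ?_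
    rw [Finset.mul_sum]
    refine Finset.sum_congr rfl fun j _ => ?_
    rw [map_mul, ← Complex.exp_conj]
    have : Complex.exp (Complex.I * (lam j - lam i : ℝ) * t)
        = Complex.exp (lam i * -(Complex.I * t)) *
          Complex.exp ((starRingEnd ℂ) (lam j * -(Complex.I * t))) := by
      rw [← Complex.exp_add]
      congr 1
      simp
      ring
    rw [this]
    ring
  have hterm (i j : ι) := norm_integral_gaussian_mul_cexp hb0 c (lam j - lam i)
  have hintC : Integrable fun t : ℝ => ((Real.exp (-b * (t - c) ^ 2) * ‖S t‖ ^ 2 : ℝ) : ℂ) := by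
    simp_rw [hexpand]
    exact integrable_finsetSum _ fun i _ => integrable_finsetSum _ fun j _ =>
      (hterm i j).1.const_mul _
  have hint : Integrable fun t : ℝ => Real.exp (-b * (t - c) ^ 2) * ‖S t‖ ^ 2 := by
    exact hintC.re
  have hbound : ∫ t : ℝ, Real.exp (-b * (t - c) ^ 2) * ‖S t‖ ^ 2
      ≤ √Real.pi * R *
        ∑ i, ∑ j, ‖a i‖ * ‖a j‖ * Real.exp (-(R * (lam i - lam j)) ^ 2 / 4) := by
    have h1 : ∫ t : ℝ, Real.exp (-b * (t - c) ^ 2) * ‖S t‖ ^ 2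
        ≤ ‖∫ t : ℝ, ((Real.exp (-b * (t - c) ^ 2) * ‖S t‖ ^ 2 : ℝ) : ℂ)‖ := by
      rw [integral_complex_ofReal, Complex.norm_real]
      exact Real.le_norm_self _
    refine h1.trans ?_
    simp_rw [hexpand]
    rw [integral_finsetSum _ fun i _ => integrable_finsetSum _ fun j _ =>
      (hterm i j).1.const_mul _, Finset.mul_sum]
    refine (norm_sum_le _ _).trans (Finset.sum_le_sum fun i _ => ?_)
    rw [integral_finsetSum _ fun j _ => (hterm i j).1.const_mul _, Finset.mul_sum]
    refine (norm_sum_le _ _).trans (Finset.sum_le_sum fun j _ => le_of_eq ?_)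
    rw [integral_const_mul, norm_mul, (hterm i j).2, norm_mul, RCLike.norm_conj]
    have hs : √(Real.pi / b) = √Real.pi * R := by
      rw [hb, div_div_eq_mul_div, div_one, Real.sqrt_mul Real.pi_pos.le, Real.sqrt_sq hR.le]
    have he : -(lam j - lam i) ^ 2 / (4 * b) = -(R * (lam i - lam j)) ^ 2 / 4 := by
      rw [hb]
      field_simp
      ring
    rw [hs, he]
    ring
  calc ∫ t in Set.Ioc c (c + T), ‖S t‖ ^ 2
      ≤ ∫ t in Set.Ioc c (c + T), Real.exp 1 * (Real.exp (-b * (t - c) ^ 2) * ‖S t‖ ^ 2) := by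
        refine setIntegral_mono_on ?_ (hint.const_mul _).integrableOn measurableSet_Ioc ?_
        · exact (Continuous.integrableOn_Icc (by fun_prop)).mono_set Set.Ioc_subset_Icc_self
        · intro t ht
          rw [← mul_assoc, ← Real.exp_add]
          refine le_mul_of_one_le_left (by positivity) (Real.one_le_exp ?_)
          have h : (t - c) ^ 2 ≤ R ^ 2 :=
            pow_le_pow_left₀ (by linarith [ht.1]) (by linarith [ht.2]) 2
          have h' : b * (t - c) ^ 2 ≤ 1 := by
            rw [hb, one_div_mul_eq_div]
            exact (div_le_one (by positivity)).2 h
          linarith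
    _ ≤ ∫ t : ℝ, Real.exp 1 * (Real.exp (-b * (t - c) ^ 2) * ‖S t‖ ^ 2) :=
        setIntegral_le_integral (hint.const_mul _) (ae_of_all _ fun t => by positivity)
    _ ≤ _ := by
        rw [integral_const_mul, mul_assoc, mul_assoc, ← mul_assoc √Real.pi]
        exact mul_le_mul_of_nonneg_left hbound (by positivity)

/-- A Schur test for kernels depending only on the difference of the labels `κ i`. -/
lemma sum_mul_mul_le_tsum_mul_sum_card_fiber {ι : Type*} [Fintype ι] (κ : ι → ℤ) (f : ι → ℝ)
    (W : ℤ → ℝ) (hW : ∀ m, 0 ≤ W m) (hWs : Summable W)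
    (hWe : ∀ m, W (-m) = W m) :
    ∑ i, ∑ j, f i * f j * W (κ i - κ j) ≤
      (∑' m, W m) * ∑ j, ((Finset.univ.filter fun i => κ i = κ j).card : ℝ) * f j ^ 2 := by
  classical
  set K := Finset.univ.image κ with hK
  have hmem : ∀ i ∈ Finset.univ, κ i ∈ K := fun i hi => Finset.mem_image_of_mem κ hi
  set B : ℤ → ℝ := fun k => ∑ i with κ i = k, f i with hB
  have hrow (k : ℤ) : ∑ l ∈ K, W (k - l) ≤ ∑' m, W m := by
    have hsum : Summable fun l => W (k - l) := hWs.comp_injective (sub_right_injective (b := k))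
    calc ∑ l ∈ K, W (k - l) ≤ ∑' l, W (k - l) := hsum.sum_le_tsum K fun l _ => hW _
      _ = ∑' m, W m := (Equiv.subLeft k).tsum_eq W
  have hgroup : ∑ i, ∑ j, f i * f j * W (κ i - κ j)
      = ∑ k ∈ K, ∑ l ∈ K, B k * B l * W (k - l) := by
    rw [← Finset.sum_fiberwise_of_maps_to hmem]
    refine Finset.sum_congr rfl fun k _ => ?_
    have hinner (i : ι) (hi : i ∈ Finset.univ.filter fun i => κ i = k) :
        ∑ j, f i * f j * W (κ i - κ j) = ∑ l ∈ K, f i * (B l * W (k - l)) := by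
      rw [← Finset.sum_fiberwise_of_maps_to hmem]
      refine Finset.sum_congr rfl fun l _ => ?_
      rw [hB, Finset.sum_mul, Finset.mul_sum]
      refine Finset.sum_congr rfl fun j hj => ?_
      rw [(Finset.mem_filter.1 hi).2, (Finset.mem_filter.1 hj).2, mul_assoc]
    rw [Finset.sum_congr rfl hinner, Finset.sum_comm]
    refine Finset.sum_congr rfl fun l _ => ?_
    rw [← Finset.sum_mul, mul_assoc]
  have hsq : ∑ k ∈ K, B k ^ 2
      ≤ ∑ j, ((Finset.univ.filter fun i => κ i = κ j).card : ℝ) * f j ^ 2 := by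
    rw [← Finset.sum_fiberwise_of_maps_to hmem]
    refine Finset.sum_le_sum fun k _ => sq_sum_le_card_mul_sum_sq.trans (le_of_eq ?_)
    rw [Finset.mul_sum]
    refine Finset.sum_congr rfl fun j hj => ?_
    rw [(Finset.mem_filter.1 hj).2]
  calc ∑ i, ∑ j, f i * f j * W (κ i - κ j)
      = ∑ k ∈ K, ∑ l ∈ K, B k * B l * W (k - l) := hgroup
    _ ≤ ∑ k ∈ K, ∑ l ∈ K, (B k ^ 2 * W (k - l) / 2 + B l ^ 2 * W (l - k) / 2) := by
        refine Finset.sum_le_sum fun k _ => Finset.sum_le_sum fun l _ => ?_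
        rw [← neg_sub k l, hWe]
        nlinarith [mul_nonneg (sq_nonneg (B k - B l)) (hW (k - l))]
    _ = ∑ k ∈ K, B k ^ 2 * ∑ l ∈ K, W (k - l) := by
        simp_rw [Finset.sum_add_distrib]
        rw [Finset.sum_comm (f := fun k l => B l ^ 2 * W (l - k) / 2), ← Finset.sum_add_distrib]
        refine Finset.sum_congr rfl fun k _ => ?_
        rw [← Finset.sum_add_distrib, Finset.mul_sum]
        exact Finset.sum_congr rfl fun l _ => by ring
    _ ≤ ∑ k ∈ K, B k ^ 2 * ∑' m, W m :=
        Finset.sum_le_sum fun k _ => mul_le_mul_of_nonneg_left (hrow k) (sq_nonneg _)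
    _ = (∑' m, W m) * ∑ k ∈ K, B k ^ 2 := by rw [← Finset.sum_mul, mul_comm]
    _ ≤ _ := mul_le_mul_of_nonneg_left hsq (tsum_nonneg hW)

lemma summable_exp_neg_abs_int : Summable fun m : ℤ => Real.exp (-|(m : ℝ)|) :=
  .of_nat_of_neg (by simpa using Real.summable_exp_neg_nat)
    (by simpa using Real.summable_exp_neg_nat)

lemma exp_neg_sq_le_exp_neg_abs_floor_sub {η R : ℝ} (hη : 0 < η) (hR : 1 / η ≤ R) (x y : ℝ) :
    Real.exp (-(R * (x - y)) ^ 2 / 4)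
      ≤ Real.exp 2 * Real.exp (-|((⌊x / η⌋ - ⌊y / η⌋ : ℤ) : ℝ)|) := by
  rw [← Real.exp_add, Real.exp_le_exp]
  have hfloor : |((⌊x / η⌋ - ⌊y / η⌋ : ℤ) : ℝ)| ≤ |x / η - y / η| + 1 := by
    push_cast
    have h1 := Int.floor_le (x / η)
    have h2 := Int.lt_floor_add_one (x / η)
    have h3 := Int.floor_le (y / η)
    have h4 := Int.lt_floor_add_one (y / η)
    rw [abs_le]
    constructor <;> linarith [le_abs_self (x / η - y / η), neg_abs_le (x / η - y / η)]
  have hscale : |x / η - y / η| ≤ |R * (x - y)| := by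
    rw [← sub_div, div_eq_inv_mul, abs_mul, abs_mul, ← one_div]
    exact mul_le_mul_of_nonneg_right (abs_le_abs_of_nonneg (by positivity) hR) (abs_nonneg _)
  nlinarith [sq_nonneg (|R * (x - y)| - 2), sq_abs (R * (x - y))]

open MeasureTheory in
/-- Mean value theorem for exponential sums with arbitrary real frequencies. -/
lemma exists_setIntegral_norm_sq_exponential_sum_le :
    ∃ C : ℝ, 0 < C ∧ ∀ (ι : Type) [Fintype ι] (lam : ι → ℝ) (a : ι → ℂ) (c T η : ℝ),
      0 < T → 0 < η →
        ∫ t in Set.Ioc c (c + T), ‖∑ j, a j * Complex.exp (lam j * -(Complex.I * t))‖ ^ 2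
          ≤ C * (T + 1 / η) *
            ∑ j, ((Finset.univ.filter fun i => |lam j - lam i| ≤ η).card : ℝ) * ‖a j‖ ^ 2 := by
  have hpos : 0 < ∑' m : ℤ, Real.exp (-|(m : ℝ)|) :=
    summable_exp_neg_abs_int.tsum_pos (fun m => (Real.exp_pos _).le) 0 (Real.exp_pos _)
  refine ⟨Real.exp 1 * √Real.pi * (Real.exp 2 * ∑' m : ℤ, Real.exp (-|(m : ℝ)|)),
    by positivity, ?_⟩
  intro ι _ lam a c T η hT hη
  have hη' : 0 < 1 / η := by positivity
  set R := T + 1 / η with hR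
  set κ : ι → ℤ := fun i => ⌊lam i / η⌋ with hκ
  have hschur := sum_mul_mul_le_tsum_mul_sum_card_fiber κ (fun i => ‖a i‖)
    (fun m => Real.exp (-|(m : ℝ)|)) (fun m => (Real.exp_pos _).le)
    summable_exp_neg_abs_int (fun m => by simp)
  have hcard (j : ι) : (Finset.univ.filter fun i => κ i = κ j).card
      ≤ (Finset.univ.filter fun i => |lam j - lam i| ≤ η).card := by
    refine Finset.card_le_card fun i hi => ?_
    simp only [Finset.mem_filter, Finset.mem_univ, true_and] at hi ⊢
    have h := Int.abs_sub_lt_one_of_floor_eq_floor hi.symm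
    rw [← sub_div, abs_div, abs_of_pos hη, div_lt_one hη] at h
    exact h.le
  calc _ ≤ Real.exp 1 * √Real.pi * R *
        ∑ i, ∑ j, ‖a i‖ * ‖a j‖ * Real.exp (-(R * (lam i - lam j)) ^ 2 / 4) :=
        setIntegral_norm_sq_exponential_sum_le lam a (by positivity) (by linarith)
    _ ≤ Real.exp 1 * √Real.pi * R * (Real.exp 2 *
        ∑ i, ∑ j, ‖a i‖ * ‖a j‖ * Real.exp (-|((κ i - κ j : ℤ) : ℝ)|)) := by
        refine mul_le_mul_of_nonneg_left ?_ (by positivity)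
        rw [Finset.mul_sum]
        refine Finset.sum_le_sum fun i _ => ?_
        rw [Finset.mul_sum]
        refine Finset.sum_le_sum fun j _ => ?_
        rw [mul_left_comm]
        exact mul_le_mul_of_nonneg_left
          (exp_neg_sq_le_exp_neg_abs_floor_sub hη (by linarith) _ _) (by positivity)
    _ ≤ Real.exp 1 * √Real.pi * R * (Real.exp 2 * ((∑' m : ℤ, Real.exp (-|(m : ℝ)|)) *
        ∑ j, ((Finset.univ.filter fun i => |lam j - lam i| ≤ η).card : ℝ) * ‖a j‖ ^ 2)) := by
        gcongr
        refine hschur.trans ?_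
        refine mul_le_mul_of_nonneg_left (Finset.sum_le_sum fun j _ => ?_) hpos.le
        exact mul_le_mul_of_nonneg_right (Nat.cast_le.2 (hcard j)) (sq_nonneg _)
    _ = _ := by ring

open MeasureTheory in
/-- Gallagher's form of the Sobolev inequality. -/
lemma norm_sq_le_setIntegral_add_deriv {f f' : ℝ → ℂ} (hf : ∀ x, HasDerivAt f (f' x) x)
    (hf' : Continuous f') {δ L : ℝ} (hδ : 0 < δ) (hL : 0 < L) (t : ℝ) :
    ‖f t‖ ^ 2 ≤ ∫ u in Set.Ioc (t - δ / 2) (t + δ / 2),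
      ((1 / δ + L) * ‖f u‖ ^ 2 + 1 / L * ‖f' u‖ ^ 2) := by
  have hfc : Continuous f := continuous_iff_continuousAt.2 fun x => (hf x).continuousAt
  set I := Set.Ioc (t - δ / 2) (t + δ / 2) with hI
  set g : ℝ → ℝ := fun u => L * ‖f u‖ ^ 2 + 1 / L * ‖f' u‖ ^ 2 with hg
  have hgc : Continuous g := by fun_prop
  have hintOn {h : ℝ → ℝ} (hh : Continuous h) : IntegrableOn h I :=
    hh.integrableOn_Icc.mono_set Set.Ioc_subset_Icc_self
  have hderiv (x : ℝ) := (hf x).norm_sq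
  have hdc : Continuous fun x => 2 * inner ℝ (f x) (f' x) := by fun_prop
  have hle (x : ℝ) : |2 * inner ℝ (f x) (f' x)| ≤ g x := by
    have h1 := abs_real_inner_le_norm (f x) (f' x)
    have h2 : g x - 2 * (‖f x‖ * ‖f' x‖) = 1 / L * (L * ‖f x‖ - ‖f' x‖) ^ 2 := by
      simp only [hg]
      field_simp
      ring
    have h3 : 0 ≤ 1 / L * (L * ‖f x‖ - ‖f' x‖) ^ 2 := by positivity
    rw [abs_mul, abs_two]
    linarith
  have hpt (u : ℝ) (hu : u ∈ I) : ‖f t‖ ^ 2 ≤ ‖f u‖ ^ 2 + ∫ x in I, g x := by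
    have hftc := intervalIntegral.integral_eq_sub_of_hasDerivAt (a := u) (b := t)
      (fun x _ => hderiv x) (hdc.intervalIntegrable _ _)
    have hsub : Set.uIoc u t ⊆ I := by
      intro x hx
      rw [Set.mem_uIoc] at hx
      rcases hx with hx | hx
      · exact ⟨hu.1.trans hx.1, by linarith [hx.2]⟩
      · exact ⟨by linarith [hx.1], hx.2.trans hu.2⟩
    have habs : ‖∫ x in u..t, 2 * inner ℝ (f x) (f' x)‖ ≤ ∫ x in I, g x :=
      calc _ ≤ ∫ x in Set.uIoc u t, ‖2 * inner ℝ (f x) (f' x)‖ :=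
            intervalIntegral.norm_integral_le_integral_norm_uIoc
        _ ≤ ∫ x in I, ‖2 * inner ℝ (f x) (f' x)‖ :=
            setIntegral_mono_set (hintOn hdc.norm) (ae_of_all _ fun x => norm_nonneg _)
              (LE.le.eventuallyLE hsub)
        _ ≤ ∫ x in I, g x := integral_mono (hintOn hdc.norm) (hintOn hgc) hle
    rw [hftc] at habs
    linarith [Real.le_norm_self (‖f t‖ ^ 2 - ‖f u‖ ^ 2)]
  have hvol : volume.real I = δ := by
    rw [hI, Real.volume_real_Ioc_of_le (by linarith)]
    ring
  have havg : δ * ‖f t‖ ^ 2 ≤ (∫ u in I, ‖f u‖ ^ 2) + δ * ∫ x in I, g x := by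
    have hfin : IntegrableOn (fun u => ‖f u‖ ^ 2) I := hintOn (by fun_prop)
    have h := setIntegral_mono_on (hintOn (continuous_const (y := ‖f t‖ ^ 2)))
      (hfin.add (hintOn (continuous_const (y := ∫ x in I, g x)))) measurableSet_Ioc hpt
    simp only [Pi.add_apply] at h
    rw [integral_add hfin (hintOn continuous_const), setIntegral_const, setIntegral_const,
      hvol] at h
    simpa using h
  have hsplit : ∫ u in I, ((1 / δ + L) * ‖f u‖ ^ 2 + 1 / L * ‖f' u‖ ^ 2)
      = 1 / δ * (∫ u in I, ‖f u‖ ^ 2) + ∫ x in I, g x := by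
    rw [← integral_const_mul, ← integral_add (hintOn (by fun_prop)) (hintOn hgc)]
    congr 1 with u
    simp only [hg]
    ring
  rw [hsplit]
  refine le_of_mul_le_mul_left (havg.trans (le_of_eq ?_)) hδ
  field_simp

open MeasureTheory in
/-- A sum over `δ`-well-spaced points is bounded by mean squares of the function and its
derivative. -/
lemma sum_norm_sq_le_setIntegral {f f' : ℝ → ℂ} (hf : ∀ x, HasDerivAt f (f' x) x)
    (hf' : Continuous f') {T₀ T δ L : ℝ} (hδ : 0 < δ) (hL : 0 < L) {s : Finset ℝ}
    (hs : ∀ t ∈ s, T₀ + δ / 2 ≤ t ∧ t ≤ T₀ + T - δ / 2)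
    (hsep : ∀ t ∈ s, ∀ t' ∈ s, t ≠ t' → δ ≤ |t - t'|) :
    ∑ t ∈ s, ‖f t‖ ^ 2 ≤ (1 / δ + L) * (∫ u in Set.Ioc T₀ (T₀ + T), ‖f u‖ ^ 2)
      + 1 / L * ∫ u in Set.Ioc T₀ (T₀ + T), ‖f' u‖ ^ 2 := by
  have hfc : Continuous f := continuous_iff_continuousAt.2 fun x => (hf x).continuousAt
  have hintOn {h : ℝ → ℝ} (hh : Continuous h) (x y : ℝ) : IntegrableOn h (Set.Ioc x y) :=
    hh.integrableOn_Icc.mono_set Set.Ioc_subset_Icc_self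
  set G : ℝ → ℝ := fun u => (1 / δ + L) * ‖f u‖ ^ 2 + 1 / L * ‖f' u‖ ^ 2 with hG
  have hGc : Continuous G := by fun_prop
  calc ∑ t ∈ s, ‖f t‖ ^ 2
      ≤ ∑ t ∈ s, ∫ u in Set.Ioc (t - δ / 2) (t + δ / 2), G u :=
        Finset.sum_le_sum fun t _ => norm_sq_le_setIntegral_add_deriv hf hf' hδ hL t
    _ = ∫ u in ⋃ t ∈ s, Set.Ioc (t - δ / 2) (t + δ / 2), G u := by
        refine (integral_biUnion_finset s (fun t _ => measurableSet_Ioc) ?_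
          fun t _ => hintOn hGc _ _).symm
        intro t ht t' ht' hne
        refine Set.disjoint_left.2 fun u hu hu' => ?_
        have h := hsep t ht t' ht' hne
        have h' : |t - t'| < δ := abs_lt.2
          ⟨by linarith [hu.2, hu'.1], by linarith [hu.1, hu'.2]⟩
        linarith
    _ ≤ ∫ u in Set.Ioc T₀ (T₀ + T), G u := by
        refine setIntegral_mono_set (hintOn hGc _ _) (ae_of_all _ fun u => ?_)
          (LE.le.eventuallyLE ?_)
        · simp only [hG, Pi.zero_apply]
          positivity
        · refine Set.iUnion₂_subset fun t ht => Set.Ioc_subset_Ioc ?_ ?_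
          · linarith [(hs t ht).1]
          · linarith [(hs t ht).2]
    _ = _ := by
        simp only [hG]
        rw [integral_add (hintOn (by fun_prop) _ _) (hintOn (by fun_prop) _ _),
          integral_const_mul, integral_const_mul]

lemma abs_sub_le_mul_abs_log_sub {N x y : ℝ} (hx : 0 < x) (hxN : x ≤ N) (hy : 0 < y)
    (hyN : y ≤ N) : |x - y| ≤ N * |Real.log x - Real.log y| := by
  wlog h : y ≤ x generalizing x y
  · rw [abs_sub_comm, abs_sub_comm (Real.log x)]
    exact this hy hyN hx hxN (le_of_not_ge h)
  have hlog : Real.log y ≤ Real.log x := Real.log_le_log hy h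
  rw [abs_of_nonneg (sub_nonneg.2 h), abs_of_nonneg (sub_nonneg.2 hlog)]
  have h1 := Real.log_le_sub_one_of_pos (div_pos hy hx)
  rw [Real.log_div hy.ne' hx.ne'] at h1
  have h2 : x * (y / x - 1) = y - x := by field_simp
  have h3 := mul_le_mul_of_nonneg_left h1 hx.le
  nlinarith [mul_le_mul_of_nonneg_right hxN (sub_nonneg.2 hlog)]

/-- Theorem 2.2: discrete mean value theorem for general Dirichlet polynomials over a
set of `δ`-well-spaced points. `χ(x, λ) = #{j : |x - n_j| ≤ λ}`. -/
theorem discrete_mvt_dirichlet_polynomials :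
    ∃ C : ℝ, 0 < C ∧
      ∀ (N : ℝ) (J : ℕ) (n : Fin J → ℝ) (a : Fin J → ℂ),
        2 ≤ N → Monotone n → (∀ j, 1 ≤ n j) → (∀ j, n j ≤ N) →
        ∀ (T₀ T δ : ℝ) (𝒯 : Finset ℝ), 0 < T → 0 < δ →
          (∀ t ∈ 𝒯, T₀ + δ / 2 ≤ t ∧ t ≤ T₀ + T - δ / 2) →
          (∀ t ∈ 𝒯, ∀ t' ∈ 𝒯, t ≠ t' → δ ≤ |t - t'|) →
          ∀ η : ℝ, 0 < η →
            (∑ t ∈ 𝒯, ‖∑ j, a j * (n j : ℂ) ^ (-(Complex.I * (t : ℂ)))‖ ^ 2) ≤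
              C * (T + 1 / η) * (Real.log N + 1 / δ) *
                ∑ j, ((Finset.univ.filter fun i => |n j - n i| ≤ η * N).card : ℝ)
                  * ‖a j‖ ^ 2 := by
  obtain ⟨C, hC, hmean⟩ := exists_setIntegral_norm_sq_exponential_sum_le
  refine ⟨2 * C, by positivity, ?_⟩
  intro N J n a hN _ hn1 hnN T₀ T δ 𝒯 hT hδ h𝒯 hsep η hη
  have hL : 0 < Real.log N := Real.log_pos (by linarith)
  have hpos (j : Fin J) : 0 < n j := by linarith [hn1 j]
  set f : ℝ → ℂ := fun t => ∑ j, a j * Complex.exp (Real.log (n j) * -(Complex.I * t)) with hf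
  set f' : ℝ → ℂ := fun t => ∑ j, (a j * (Real.log (n j) * -Complex.I)) *
    Complex.exp (Real.log (n j) * -(Complex.I * t)) with hf'
  have hcpow (t : ℝ) : ∑ j, a j * (n j : ℂ) ^ (-(Complex.I * (t : ℂ))) = f t :=
    Finset.sum_congr rfl fun j _ => by
      rw [Complex.cpow_def_of_ne_zero (by exact_mod_cast (hpos j).ne'),
        Complex.ofReal_log (hpos j).le]
  have hderiv (t : ℝ) : HasDerivAt f (f' t) t := by
    refine HasDerivAt.fun_sum fun j _ => ?_
    have h := (((Complex.ofRealCLM.hasDerivAt (x := t)).const_mul Complex.I).neg.const_mul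
      (Real.log (n j) : ℂ)).cexp.const_mul (a j)
    refine h.congr_deriv ?_
    simp
    ring
  set X : ℝ := ∑ j, ((Finset.univ.filter fun i => |n j - n i| ≤ η * N).card : ℝ) * ‖a j‖ ^ 2
    with hX
  have hX0 : 0 ≤ X := Finset.sum_nonneg fun j _ => mul_nonneg (Nat.cast_nonneg _) (sq_nonneg _)
  have hcard (j : Fin J) :
      ((Finset.univ.filter fun i => |Real.log (n j) - Real.log (n i)| ≤ η).card : ℝ)
        ≤ (Finset.univ.filter fun i => |n j - n i| ≤ η * N).card := by
    refine Nat.cast_le.2 (Finset.card_le_card fun i hi => ?_)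
    simp only [Finset.mem_filter, Finset.mem_univ, true_and] at hi ⊢
    have h := abs_sub_le_mul_abs_log_sub (hpos j) (hnN j) (hpos i) (hnN i)
    nlinarith
  have hR : 0 < T + 1 / η := by positivity
  have hmean_f : ∫ u in Set.Ioc T₀ (T₀ + T), ‖f u‖ ^ 2 ≤ C * (T + 1 / η) * X := by
    refine (hmean (Fin J) (fun j => Real.log (n j)) a T₀ T η hT hη).trans ?_
    refine mul_le_mul_of_nonneg_left (Finset.sum_le_sum fun j _ => ?_) (by positivity)
    exact mul_le_mul_of_nonneg_right (hcard j) (sq_nonneg _)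
  have hmean_f' : ∫ u in Set.Ioc T₀ (T₀ + T), ‖f' u‖ ^ 2
      ≤ C * (T + 1 / η) * (Real.log N ^ 2 * X) := by
    refine (hmean (Fin J) (fun j => Real.log (n j))
      (fun j => a j * (Real.log (n j) * -Complex.I)) T₀ T η hT hη).trans ?_
    refine mul_le_mul_of_nonneg_left ?_ (by positivity)
    rw [hX, Finset.mul_sum]
    refine Finset.sum_le_sum fun j _ => ?_
    have hlog0 : 0 ≤ Real.log (n j) := Real.log_nonneg (hn1 j)
    have hlogN : Real.log (n j) ≤ Real.log N := Real.log_le_log (hpos j) (hnN j)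
    have hnorm : ‖a j * (Real.log (n j) * -Complex.I)‖ ^ 2 = Real.log (n j) ^ 2 * ‖a j‖ ^ 2 := by
      rw [norm_mul, norm_mul, norm_neg, Complex.norm_I, mul_one, Complex.norm_real,
        Real.norm_eq_abs, mul_pow, sq_abs, mul_comm]
    rw [hnorm, mul_left_comm]
    exact mul_le_mul (pow_le_pow_left₀ hlog0 hlogN 2)
      (mul_le_mul_of_nonneg_right (hcard j) (sq_nonneg _)) (by positivity) (by positivity)
  clear_value X
  simp_rw [hcpow]
  refine (sum_norm_sq_le_setIntegral hderiv (by fun_prop) hδ hL h𝒯 hsep).trans ?_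
  calc _ ≤ (1 / δ + Real.log N) * (C * (T + 1 / η) * X)
        + 1 / Real.log N * (C * (T + 1 / η) * (Real.log N ^ 2 * X)) := by gcongr
    _ = C * (T + 1 / η) * X * (1 / δ + 2 * Real.log N) := by
        field_simp
        ring
    _ ≤ C * (T + 1 / η) * X * (2 * (Real.log N + 1 / δ)) := by
        refine mul_le_mul_of_nonneg_left ?_ (by positivity)
        have : 0 < 1 / δ := by positivity
        linarith
    _ = _ := by ring
end

section
/- Let (𝒫, 𝒩) be a Beurling generalized number system whose integers are θ-well-behaved for some θ ∈ [0,1). Then there is a constant C (depending only on the system) such that for all T ≥ 2: (1/T) ∫_0^T |ζ_𝒫((1+θ)/2 + it)|² dt ≤ C log T and (1/T) ∫_0^T |ζ'_𝒫((1+θ)/2 + it)|² dt ≤ C (log T)³, where ζ_𝒫 and ζ'_𝒫 denote the analytic continuation of ζ_𝒫 and its derivative. -/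
open Filter Asymptotics

/-- A Beurling generalized number system: a nondecreasing sequence of generalized
primes `p` with `1 < p 0` tending to infinity, together with the nondecreasing
enumeration `n` (with multiplicity) of all finite products of the generalized primes,
witnessed by the bijection `equiv` from exponent vectors to indices. -/
structure BeurlingSystem where
  p : ℕ → ℝ
  n : ℕ → ℝ
  one_lt_p : 1 < p 0
  mono_p : Monotone p
  tendsto_p : Tendsto p atTop atTop
  mono_n : Monotone n
  equiv : (ℕ →₀ ℕ) ≃ ℕ
  n_eq : ∀ k : ℕ →₀ ℕ, n (equiv k) = ∏ j ∈ k.support, p j ^ k j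

/-- The integer counting function `N_𝒫(x)`. -/
noncomputable def BeurlingSystem.Nint (S : BeurlingSystem) (x : ℝ) : ℕ :=
  {j : ℕ | S.n j ≤ x}.ncard

/-- `Z` is an analytic continuation of the Beurling zeta function of the system `S`
to the half-plane `Re s > θ`, with density `A`: it agrees with the Dirichlet series
on `Re s > 1` and `Z s - A/(s-1)` is analytic on `Re s > θ`. -/
def BeurlingSystem.IsZeta (S : BeurlingSystem) (θ A : ℝ) (Z : ℂ → ℂ) : Prop :=
  (∀ s : ℂ, 1 < s.re → Z s = ∑' j : ℕ, (S.n j : ℂ) ^ (-s)) ∧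
    DifferentiableOn ℂ (fun s => Z s - (A : ℂ) / (s - 1)) {s : ℂ | θ < s.re}

/-- The number of zeros (without multiplicity) of `Z` with `α ≤ Re ρ` and `|Im ρ| ≤ T`. -/
noncomputable def zeroCount (Z : ℂ → ℂ) (α T : ℝ) : ℕ :=
  {ρ : ℂ | Z ρ = 0 ∧ α ≤ ρ.re ∧ |ρ.im| ≤ T}.ncard

open MeasureTheory FourierTransform SchwartzMap in
theorem fourier_ae_eq_toLp {φ : ℝ → ℂ} (h1 : Integrable φ) (h2 : MemLp φ 2) :
    (𝓕 φ : ℝ → ℂ) =ᵐ[volume] (𝓕 (h2.toLp φ) : Lp (α := ℝ) ℂ 2) := by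
  have hcont : Continuous (𝓕 φ : ℝ → ℂ) :=
    VectorFourier.fourierIntegral_continuous Real.continuous_fourierChar
      (by exact continuous_inner) h1
  refine ae_eq_of_integral_contDiff_smul_eq hcont.locallyIntegrable
    ((Lp.memLp _).locallyIntegrable (by norm_num)) fun g hg hgc => ?_
  have hg₁ : HasCompactSupport (Complex.ofRealCLM ∘ g) := hgc.comp_left rfl
  have hg₂ : ContDiff ℝ (↑(⊤ : ℕ∞)) (Complex.ofRealCLM ∘ g) := by fun_prop
  set G : 𝓢(ℝ, ℂ) := hg₁.toSchwartzMap hg₂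
  have hG : ∀ x, G x = (g x : ℂ) := fun x => by simp [G]
  have key := DFunLike.congr_fun (Lp.fourier_toTemperedDistribution_eq (h2.toLp φ)) G
  rw [TemperedDistribution.fourier_apply, Lp.toTemperedDistribution_apply,
    Lp.toTemperedDistribution_apply] at key
  have e1 : ∫ x, g x • (𝓕 φ : ℝ → ℂ) x = ∫ x, (𝓕 G) x • φ x := by
    have := VectorFourier.integral_fourierIntegral_smul_eq_flip (μ := volume) (ν := volume)
      (L := innerₗ ℝ) Real.continuous_fourierChar (by exact continuous_inner) G.integrable h1
    rw [flip_innerₗ] at this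
    rw [SchwartzMap.fourier_coe]
    refine Eq.trans ?_ this.symm
    exact integral_congr_ae (Eventually.of_forall fun x => by
      beta_reduce
      rw [hG, Complex.real_smul, smul_eq_mul]; rfl)
  rw [e1]
  calc ∫ x, (𝓕 G) x • φ x = ∫ x, (𝓕 G) x • (h2.toLp φ) x := by
        refine integral_congr_ae ?_
        filter_upwards [h2.coeFn_toLp] with x hx
        rw [hx]
    _ = _ := by
        rw [key]
        exact integral_congr_ae (Eventually.of_forall fun x => by simp [hG])

open MeasureTheory FourierTransform in
theorem plancherel_of_integrable {φ : ℝ → ℂ} (h1 : Integrable φ) (h2 : MemLp φ 2) :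
    Integrable (fun ξ => ‖(𝓕 φ : ℝ → ℂ) ξ‖ ^ 2) ∧
      ∫ ξ, ‖(𝓕 φ : ℝ → ℂ) ξ‖ ^ 2 = ∫ u, ‖φ u‖ ^ 2 := by
  have hae := fourier_ae_eq_toLp h1 h2
  have hL : ∀ f : Lp ℂ 2 (volume : Measure ℝ), ∫ x, ‖f x‖ ^ 2 = ‖f‖ ^ 2 := fun f => by
    have h : inner ℂ f f = ((∫ x, ‖f x‖ ^ 2 : ℝ) : ℂ) := by
      rw [L2.inner_def, ← integral_complex_ofReal]
      exact integral_congr_ae (Eventually.of_forall fun x => by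
        simp only [inner_self_eq_norm_sq_to_K]; push_cast; rfl)
    rw [inner_self_eq_norm_sq_to_K] at h
    exact Complex.ofReal_injective (h.symm.trans (by push_cast; rfl))
  have hm : MemLp (𝓕 φ : ℝ → ℂ) 2 := (memLp_congr_ae hae).2 (Lp.memLp _)
  refine ⟨(memLp_two_iff_integrable_sq_norm hm.1).1 hm, ?_⟩
  calc _ = ∫ x, ‖(𝓕 (h2.toLp φ) : Lp ℂ 2 (volume : Measure ℝ)) x‖ ^ 2 :=
        integral_congr_ae (by filter_upwards [hae] with x hx; rw [hx])
    _ = ∫ x, ‖h2.toLp φ x‖ ^ 2 := by rw [hL, hL, Lp.norm_fourier_eq]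
    _ = _ := integral_congr_ae (by filter_upwards [h2.coeFn_toLp] with x hx; rw [hx])

open MeasureTheory

theorem Real.exp_sub_one_le_two_mul {x : ℝ} (h0 : 0 ≤ x) (h1 : x ≤ 1) : Real.exp x - 1 ≤ 2 * x := by
  have := Real.abs_exp_sub_one_le (x := x) (by rw [abs_of_nonneg h0]; exact h1)
  rw [abs_of_nonneg h0] at this
  exact (le_abs_self _).trans this

theorem abs_pow_le_mul_exp {c : ℝ} (hc : 0 < c) (k : ℕ) {u : ℝ} (hu : -1 ≤ u) :
    |u| ^ k ≤ k.factorial * (1 / c) ^ k * Real.exp (2 * c) * Real.exp (c * u) := by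
  have h := Real.pow_div_factorial_le_exp (c * |u|) (by positivity) k
  have hf : (0 : ℝ) < k.factorial := by positivity
  rw [div_le_iff₀ hf] at h
  have hu2 : c * |u| ≤ 2 * c + c * u := by
    rcases abs_cases u with ⟨h, _⟩ | ⟨h, _⟩ <;> rw [h] <;> nlinarith
  calc |u| ^ k = (1 / c) ^ k * (c * |u|) ^ k := by
        rw [← mul_pow]; congr 1; field_simp
    _ ≤ (1 / c) ^ k * (Real.exp (2 * c + c * u) * k.factorial) := by
        gcongr
        exact h.trans (by gcongr)
    _ = _ := by rw [Real.exp_add]; ring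

/-- A measurable function `e` supported on `[0, ∞)`, of size at most `B * exp (θ u)`, such that
`e u + A * exp u` is nondecreasing for `u ≥ 0`. -/
structure IsRemainder (e : ℝ → ℝ) (θ A B : ℝ) : Prop where
  measurable : Measurable e
  eq_zero : ∀ u < 0, e u = 0
  abs_le : ∀ u, |e u| ≤ B * Real.exp (θ * u)
  mono : ∀ u v, 0 ≤ u → u ≤ v → e u + A * Real.exp u ≤ e v + A * Real.exp v

namespace IsRemainder

variable {e : ℝ → ℝ} {θ A B : ℝ}

theorem nonneg (h : IsRemainder e θ A B) : 0 ≤ B := by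
  simpa using (abs_nonneg _).trans (h.abs_le 0)

theorem abs_sub_le (h : IsRemainder e θ A B) (hθ : θ ≤ 1) {δ : ℝ} (hδ0 : 0 ≤ δ)
    (hδ1 : δ ≤ 1) (u : ℝ) : |e (u + δ) - e u| ≤ 4 * B * Real.exp (θ * u) := by
  have h1 := h.abs_le (u + δ)
  have h2 := h.abs_le u
  have hB := h.nonneg
  have h3 : Real.exp (θ * (u + δ)) ≤ 3 * Real.exp (θ * u) := by
    rw [mul_add, Real.exp_add, mul_comm]
    gcongr
    calc Real.exp (θ * δ) ≤ Real.exp 1 := by gcongr; nlinarith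
      _ ≤ 3 := by linarith [Real.exp_one_lt_d9]
  have h4 : B * Real.exp (θ * (u + δ)) ≤ B * (3 * Real.exp (θ * u)) := by gcongr
  exact (abs_sub _ _).trans (by linarith)

theorem integral_exp_neg_mul_sub_le (h : IsRemainder e θ A B) (hθ : θ ≤ 1) {δ U : ℝ}
    (hδ0 : 0 ≤ δ) (hδ1 : δ ≤ 1) (hU : 0 ≤ U) :
    ∫ u in (0 : ℝ)..U, Real.exp (-u) * (e (u + δ) - e u) ≤ 2 * B * δ * (U + 1) := by
  set m : ℝ → ℝ := fun u => Real.exp (-u) * e u with hm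
  have hmm : Measurable m := by have := h.measurable; fun_prop
  have hmb : ∀ u, 0 ≤ u → ‖m u‖ ≤ B := fun u hu => by
    rw [hm, Real.norm_eq_abs, abs_mul, Real.abs_exp]
    calc _ ≤ Real.exp (-u) * (B * Real.exp (θ * u)) := by gcongr; exact h.abs_le u
      _ = B * Real.exp (-u + θ * u) := by rw [Real.exp_add]; ring
      _ ≤ B * 1 := by
        have := h.nonneg
        gcongr
        exact Real.exp_le_one_iff.2 (by nlinarith)
      _ = B := mul_one _
  have hmi : ∀ a b, 0 ≤ a → 0 ≤ b → IntervalIntegrable m volume a b := fun a b ha hb => by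
    refine (intervalIntegrable_const (c := B)).mono_fun hmm.aestronglyMeasurable ?_
    refine (ae_restrict_iff' measurableSet_uIoc).2 (Eventually.of_forall fun u hu => ?_)
    refine (hmb u ?_).trans (le_abs_self _)
    exact (le_min ha hb).trans hu.1.le
  have hbd : ∀ a b, 0 ≤ a → a ≤ b → |∫ u in a..b, m u| ≤ B * (b - a) := fun a b ha hab => by
    have := intervalIntegral.norm_integral_le_of_norm_le_const (f := m) (C := B) (a := a) (b := b)
      (fun u hu => hmb u (ha.trans (by rw [Set.uIoc_of_le hab] at hu; exact hu.1.le)))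
    rwa [abs_of_nonneg (sub_nonneg.2 hab)] at this
  have hshift : ∀ u, Real.exp (-u) * (e (u + δ) - e u) = Real.exp δ * m (u + δ) - m u := fun u => by
    simp only [hm]
    rw [← mul_assoc, ← Real.exp_add]
    ring_nf
  have hsi : IntervalIntegrable (fun u => m (u + δ)) volume 0 U := by
    have := (hmi δ (U + δ) hδ0 (by linarith)).comp_add_right (c := δ)
    simpa using this
  simp only [hshift]
  rw [intervalIntegral.integral_sub (hsi.const_mul _) (hmi 0 U le_rfl hU),
    intervalIntegral.integral_const_mul, intervalIntegral.integral_comp_add_right, zero_add]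
  have e1 := intervalIntegral.integral_add_adjacent_intervals
    (hmi 0 δ le_rfl hδ0) (hmi δ (U + δ) hδ0 (by linarith))
  have e2 := intervalIntegral.integral_add_adjacent_intervals
    (hmi 0 U le_rfl hU) (hmi U (U + δ) hU (by linarith))
  have b1 := (_root_.abs_le.1 (hbd 0 δ le_rfl hδ0)).1
  have b2 := (_root_.abs_le.1 (hbd U (U + δ) hU (by linarith))).2
  have b3 := (_root_.abs_le.1 (hbd δ (U + δ) hδ0 (by linarith))).2
  have b4 : (Real.exp δ - 1) * ∫ u in δ..(U + δ), m u ≤ (2 * δ) * (B * U) := by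
    have : B * (U + δ - δ) = B * U := by ring
    rw [this] at b3
    have hBU : 0 ≤ B * U := mul_nonneg h.nonneg hU
    calc _ ≤ (Real.exp δ - 1) * (B * U) := by
          gcongr
          linarith [Real.add_one_le_exp δ]
      _ ≤ _ := by
          gcongr
          exact Real.exp_sub_one_le_two_mul hδ0 hδ1
  nlinarith

theorem sub_eq_zero_of_lt (h : IsRemainder e θ A B) {δ u : ℝ} (hδ : 0 ≤ δ) (hu : u < -δ) :
    e (u + δ) - e u = 0 := by
  rw [h.eq_zero _ (by linarith), h.eq_zero _ (by linarith), sub_zero]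

/-- The truncated exponential dominating the weighted differences. -/
theorem _root_.integrable_indicator_exp {c : ℝ} (hc : 0 < c) (K a : ℝ) :
    Integrable ((Set.Ioi a).indicator fun u => K * Real.exp (-c * u)) := by
  rw [integrable_indicator_iff measurableSet_Ioi]
  exact (integrableOn_exp_mul_Ioi (neg_lt_zero.2 hc) a).const_mul K

theorem integrable_pow_mul (h : IsRemainder e θ A B) (hθ : θ ≤ 1) {δ : ℝ} (hδ0 : 0 ≤ δ)
    (hδ1 : δ < 1) {r : ℝ} (hr : θ < r) (k : ℕ) :
    Integrable (fun u => u ^ k * (e (u + δ) - e u) * Real.exp (-r * u)) := by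
  set c := (r - θ) / 2 with hc
  have hc0 : 0 < c := by rw [hc]; linarith
  set K := k.factorial * (1 / c) ^ k * Real.exp (2 * c)
  refine (integrable_indicator_exp hc0 (4 * B * K) (-1)).mono' ?_
    (Eventually.of_forall fun u => ?_)
  · have := h.measurable
    exact Measurable.aestronglyMeasurable (by fun_prop)
  · by_cases hu : u < -δ
    · rw [h.sub_eq_zero_of_lt hδ0 hu]
      have := h.nonneg
      simp only [mul_zero, zero_mul, norm_zero]
      exact Set.indicator_nonneg (fun x _ => by positivity) _
    · have hu1 : -1 < u := by linarith
      rw [Set.indicator_of_mem (by exact hu1), norm_mul, norm_mul, norm_pow, Real.norm_eq_abs,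
        Real.norm_eq_abs, Real.norm_eq_abs, Real.abs_exp]
      calc _ ≤ (K * Real.exp (c * u)) * (4 * B * Real.exp (θ * u)) * Real.exp (-r * u) := by
            gcongr
            · exact abs_pow_le_mul_exp hc0 k hu1.le
            · exact h.abs_sub_le hθ hδ0 hδ1.le u
        _ = 4 * B * K * (Real.exp (c * u) * Real.exp (θ * u) * Real.exp (-r * u)) := by ring
        _ = _ := by
            rw [← Real.exp_add, ← Real.exp_add]; congr 2; rw [hc]; ring

theorem integrable_pow_mul_sq (h : IsRemainder e θ A B) (hθ : θ < 1) {δ : ℝ} (hδ0 : 0 ≤ δ)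
    (hδ1 : δ < 1) (k : ℕ) :
    Integrable (fun u => |u| ^ k * (e (u + δ) - e u) ^ 2 * Real.exp (-(1 + θ) * u)) := by
  refine (((h.integrable_pow_mul hθ.le hδ0 hδ1 (r := 1) hθ k).norm).const_mul (4 * B)).mono' ?_
    (Eventually.of_forall fun u => ?_)
  · have := h.measurable
    exact Measurable.aestronglyMeasurable (by fun_prop)
  · rw [norm_mul, norm_mul, norm_mul, norm_mul, norm_pow, norm_pow, norm_pow, Real.norm_eq_abs,
      Real.norm_eq_abs, Real.norm_eq_abs, Real.norm_eq_abs, Real.norm_eq_abs,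
      Real.abs_exp, Real.abs_exp, abs_abs]
    have hb := h.abs_sub_le hθ.le hδ0 hδ1.le u
    calc |u| ^ k * |e (u + δ) - e u| ^ 2 * Real.exp (-(1 + θ) * u)
        = |u| ^ k * (|e (u + δ) - e u| * |e (u + δ) - e u|) * Real.exp (-(1 + θ) * u) := by ring
      _ ≤ |u| ^ k * (|e (u + δ) - e u| * (4 * B * Real.exp (θ * u)))
            * Real.exp (-(1 + θ) * u) := by gcongr
      _ = 4 * B * (|u| ^ k * |e (u + δ) - e u| *
            (Real.exp (θ * u) * Real.exp (-(1 + θ) * u))) := by ring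
      _ = _ := by rw [← Real.exp_add]; congr 3; ring

theorem exists_integral_sq_le (h : IsRemainder e θ A B) (hA : 0 ≤ A) (hθ0 : 0 ≤ θ) (hθ : θ < 1)
    (k : ℕ) : ∃ C, 0 ≤ C ∧ ∀ T : ℝ, 2 ≤ T →
      ∫ u, |u| ^ k * (e (u + 1 / T) - e u) ^ 2 * Real.exp (-(1 + θ) * u) ≤
        C * (1 / T) * Real.log T ^ (k + 1) := by
  have hB := h.nonneg
  set c := (1 - θ) / 2 with hc
  have hc0 : 0 < c := by rw [hc]; linarith
  set K := k.factorial * (1 / c) ^ k * Real.exp (2 * c)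
  have hK : 0 ≤ K := by positivity
  refine ⟨(16 * B ^ 2 * (Real.exp 2 + K / c)) * 2 ^ (k + 1) +
    (1 / c) ^ k * (4 * B) * (2 * B + 4 * A) * (1 / c + 2), by positivity, fun T hT => ?_⟩
  set L := Real.log T with hL
  have hL2 : 1 ≤ 2 * L := by
    have : Real.log 2 ≤ L := Real.log_le_log (by norm_num) hT
    linarith [Real.log_two_gt_d9]
  have hL0 : 0 ≤ L := by linarith
  set δ := 1 / T with hδ
  have hT0 : 0 < T := by linarith
  have hδ0 : 0 ≤ δ := by positivity
  have hδ1 : δ < 1 := by rw [hδ, div_lt_one hT0]; linarith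
  set U := L / c with hU
  have hU0 : 0 ≤ U := by positivity
  have hUexp : Real.exp (-c * U) = δ := by
    rw [hU, hδ, neg_mul, mul_div_cancel₀ _ hc0.ne', Real.exp_neg, hL, Real.exp_log hT0, one_div]
  set f : ℝ → ℝ := fun u => |u| ^ k * (e (u + δ) - e u) ^ 2 * Real.exp (-(1 + θ) * u) with hf
  have hfi : Integrable f := h.integrable_pow_mul_sq hθ hδ0 hδ1 k
  set g : ℝ → ℝ := fun u => U ^ k * (4 * B) * (Real.exp (-u) * (e (u + δ) - e u) + 4 * A * δ)
  have hsq : ∀ u, f u ≤ |u| ^ k * (16 * B ^ 2) * Real.exp (-(2 * c) * u) := fun u => by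
    have hb := h.abs_sub_le hθ.le hδ0 hδ1.le u
    calc f u = |u| ^ k * |e (u + δ) - e u| ^ 2 * Real.exp (-(1 + θ) * u) := by rw [hf, sq_abs]
      _ ≤ |u| ^ k * (4 * B * Real.exp (θ * u)) ^ 2 * Real.exp (-(1 + θ) * u) := by gcongr
      _ = |u| ^ k * (16 * B ^ 2) *
          (Real.exp (θ * u) * Real.exp (θ * u) * Real.exp (-(1 + θ) * u)) := by ring
      _ = _ := by rw [← Real.exp_add, ← Real.exp_add]; congr 2; rw [hc]; ring
  have hgi : IntegrableOn g (Set.Ioc 0 U) := by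
    have h1 := h.integrable_pow_mul hθ.le hδ0 hδ1 (r := 1) hθ 0
    have h2 : Integrable (fun u => Real.exp (-u) * (e (u + δ) - e u)) := by
      convert h1 using 2 with u
      rw [pow_zero, one_mul, neg_one_mul, mul_comm]
    exact (h2.integrableOn.add (integrableOn_const (by simp))).const_mul _
  have i1 : ∫ u in Set.Iic 0, f u ≤ 16 * B ^ 2 * Real.exp 2 * δ := by
    have : ∀ u ∈ Set.Iic (0 : ℝ), f u ≤
        (Set.Icc (-δ) 0).indicator (fun _ => 16 * B ^ 2 * Real.exp 2) u := fun u hu => by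
      by_cases hu' : u < -δ
      · rw [Set.indicator_of_notMem (fun hh => absurd hh.1 (not_le.2 hu')), hf]
        simp only [h.sub_eq_zero_of_lt hδ0 hu']
        simp
      · have hu1 : -δ ≤ u := not_lt.1 hu'
        rw [Set.indicator_of_mem (show u ∈ Set.Icc (-δ) 0 from ⟨hu1, hu⟩)]
        refine (hsq u).trans ?_
        have hu2 : u ≤ 0 := hu
        have habs : |u| ≤ 1 := _root_.abs_le.2 ⟨by linarith, by linarith⟩
        calc _ ≤ 1 * (16 * B ^ 2) * Real.exp 2 := by
              gcongr
              · exact pow_le_one₀ (abs_nonneg _) habs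
              · have : 2 * c ≤ 2 := by rw [hc]; linarith
                nlinarith
          _ = _ := by ring
    have hint : Integrable ((Set.Icc (-δ) 0).indicator (fun _ : ℝ => 16 * B ^ 2 * Real.exp 2)) := by
      rw [integrable_indicator_iff measurableSet_Icc]
      exact integrableOn_const (by simp)
    calc _ ≤ ∫ u in Set.Iic 0, (Set.Icc (-δ) 0).indicator (fun _ => 16 * B ^ 2 * Real.exp 2) u :=
          setIntegral_mono_on hfi.integrableOn hint.integrableOn measurableSet_Iic this
      _ ≤ ∫ u, (Set.Icc (-δ) 0).indicator (fun _ => 16 * B ^ 2 * Real.exp 2) u :=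
          setIntegral_le_integral hint (Eventually.of_forall fun u =>
            Set.indicator_nonneg (fun x _ => by positivity) _)
      _ = _ := by
          rw [integral_indicator measurableSet_Icc, setIntegral_const]
          simp [hδ0]
          ring
  have i2 : ∫ u in Set.Ioc 0 U, f u ≤ U ^ k * (4 * B) * ((2 * B + 4 * A) * δ * (U + 1)) := by
    have : ∀ u ∈ Set.Ioc 0 U, f u ≤ g u := fun u hu => by
      have hu0 : 0 ≤ u := hu.1.le
      have hb := h.abs_sub_le hθ.le hδ0 hδ1.le u
      have hm := h.mono u (u + δ) hu0 (by linarith)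
      have hexp : Real.exp (u + δ) - Real.exp u ≤ Real.exp u * (2 * δ) := by
        rw [Real.exp_add]
        nlinarith [Real.exp_sub_one_le_two_mul hδ0 hδ1.le, Real.exp_pos u]
      have hexp0 : Real.exp u ≤ Real.exp (u + δ) := by gcongr; linarith
      have hD : |e (u + δ) - e u| ≤ (e (u + δ) - e u) + 4 * A * δ * Real.exp u := by
        have h1 : A * (Real.exp (u + δ) - Real.exp u) ≤ A * (Real.exp u * (2 * δ)) := by gcongr
        have h2 : 0 ≤ A * (Real.exp (u + δ) - Real.exp u) :=
          mul_nonneg hA (by linarith)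
        rcases abs_cases (e (u + δ) - e u) with ⟨h, _⟩ | ⟨h, _⟩ <;> rw [h] <;> linarith
      calc f u = |u| ^ k * (|e (u + δ) - e u| * |e (u + δ) - e u|) *
            Real.exp (-(1 + θ) * u) := by rw [hf, abs_mul_abs_self]; ring
        _ ≤ U ^ k * (((e (u + δ) - e u) + 4 * A * δ * Real.exp u) * (4 * B * Real.exp (θ * u))) *
            Real.exp (-(1 + θ) * u) := by
            have : |u| ≤ U := by rw [abs_of_nonneg hu0]; exact hu.2
            gcongr
            exact (abs_nonneg _).trans hD
        _ = U ^ k * (4 * B) * ((e (u + δ) - e u) *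
              (Real.exp (θ * u) * Real.exp (-(1 + θ) * u)) + 4 * A * δ *
              (Real.exp u * (Real.exp (θ * u) * Real.exp (-(1 + θ) * u)))) := by ring
        _ = g u := by
            have h1 : Real.exp (θ * u) * Real.exp (-(1 + θ) * u) = Real.exp (-u) := by
              rw [← Real.exp_add]; congr 1; ring
            have h2 : Real.exp u * Real.exp (-u) = 1 := by rw [← Real.exp_add]; simp
            rw [h1, h2]
            ring
    calc _ ≤ ∫ u in Set.Ioc 0 U, g u :=
          setIntegral_mono_on hfi.integrableOn hgi measurableSet_Ioc this
      _ = U ^ k * (4 * B) * ((∫ u in (0 : ℝ)..U, Real.exp (-u) * (e (u + δ) - e u)) +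
            4 * A * δ * U) := by
          have h1 := h.integrable_pow_mul hθ.le hδ0 hδ1 (r := 1) hθ 0
          have h2 : Integrable (fun u => Real.exp (-u) * (e (u + δ) - e u)) := by
            convert h1 using 2 with u
            rw [pow_zero, one_mul, neg_one_mul, mul_comm]
          rw [integral_const_mul, integral_add h2.integrableOn (integrableOn_const (by simp)),
            intervalIntegral.integral_of_le hU0, setIntegral_const]
          simp [hU0]
          ring_nf
          simp
      _ ≤ U ^ k * (4 * B) * (2 * B * δ * (U + 1) + 4 * A * δ * U) := by
          gcongr
          exact h.integral_exp_neg_mul_sub_le hθ.le hδ0 hδ1.le hU0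
      _ ≤ _ := by
          gcongr
          have : 0 ≤ A * δ := by positivity
          nlinarith
  have i3 : ∫ u in Set.Ioi U, f u ≤ 16 * B ^ 2 * (K / c) * δ := by
    have : ∀ u ∈ Set.Ioi U, f u ≤ 16 * B ^ 2 * K * Real.exp (-c * u) := fun u hu => by
      have hu0 : U < u := hu
      refine (hsq u).trans ?_
      calc _ ≤ (K * Real.exp (c * u)) * (16 * B ^ 2) * Real.exp (-(2 * c) * u) := by
            gcongr
            exact abs_pow_le_mul_exp hc0 k (by linarith)
        _ = 16 * B ^ 2 * K * (Real.exp (c * u) * Real.exp (-(2 * c) * u)) := by ring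
        _ = _ := by rw [← Real.exp_add]; congr 2; ring
    calc _ ≤ ∫ u in Set.Ioi U, 16 * B ^ 2 * K * Real.exp (-c * u) :=
          setIntegral_mono_on hfi.integrableOn
            ((integrableOn_exp_mul_Ioi (neg_lt_zero.2 hc0) U).const_mul _) measurableSet_Ioi this
      _ = _ := by
          rw [integral_const_mul, integral_exp_mul_Ioi (neg_lt_zero.2 hc0), hUexp]
          field_simp
  have hsplit : ∫ u, f u = (∫ u in Set.Iic 0, f u) + ((∫ u in Set.Ioc 0 U, f u) +
      ∫ u in Set.Ioi U, f u) := by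
    rw [← setIntegral_union (Set.Ioc_disjoint_Ioi le_rfl) measurableSet_Ioi hfi.integrableOn
      hfi.integrableOn, Set.Ioc_union_Ioi_eq_Ioi hU0,
      intervalIntegral.integral_Iic_add_Ioi hfi.integrableOn hfi.integrableOn]
  have hpow : 1 ≤ 2 ^ (k + 1) * L ^ (k + 1) := by
    rw [← mul_pow]; exact one_le_pow₀ hL2
  have hU1 : U ^ k * (U + 1) ≤ (1 / c) ^ k * (1 / c + 2) * L ^ (k + 1) := by
    have h1 : U + 1 ≤ (1 / c + 2) * L := by
      rw [hU, add_mul, one_div, div_eq_inv_mul]; linarith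
    calc U ^ k * (U + 1) ≤ U ^ k * ((1 / c + 2) * L) := by gcongr
      _ = _ := by rw [hU, div_pow, one_div, div_eq_mul_inv, ← inv_pow, pow_succ]; ring
  calc ∫ u, f u ≤ 16 * B ^ 2 * Real.exp 2 * δ + (U ^ k * (4 * B) * ((2 * B + 4 * A) * δ * (U + 1))
        + 16 * B ^ 2 * (K / c) * δ) := by rw [hsplit]; gcongr
    _ = 16 * B ^ 2 * (Real.exp 2 + K / c) * δ * 1 +
        (4 * B) * (2 * B + 4 * A) * δ * (U ^ k * (U + 1)) := by ring
    _ ≤ 16 * B ^ 2 * (Real.exp 2 + K / c) * δ * (2 ^ (k + 1) * L ^ (k + 1)) +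
        (4 * B) * (2 * B + 4 * A) * δ * ((1 / c) ^ k * (1 / c + 2) * L ^ (k + 1)) := by
        gcongr
    _ = _ := by ring

end IsRemainder

theorem measurable_comp_neg_log {w : ℝ → ℝ} (hw : Measurable w) :
    Measurable fun t : ℝ => (w (-Real.log t) : ℂ) :=
  Complex.measurable_ofReal.comp (hw.comp Real.measurable_log.neg)

theorem norm_comp_neg_log_le {w : ℝ → ℝ} {θ B : ℝ} (hb : ∀ u, |w u| ≤ B * Real.exp (θ * u))
    {t : ℝ} (ht : 0 < t) : ‖(w (-Real.log t) : ℂ)‖ ≤ B * t ^ (-θ) := by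
  rw [Complex.norm_real, Real.norm_eq_abs, Real.rpow_def_of_pos ht]
  refine (hb _).trans_eq ?_
  ring_nf

theorem locallyIntegrableOn_comp_neg_log {w : ℝ → ℝ} {θ B : ℝ} (hw : Measurable w)
    (hb : ∀ u, |w u| ≤ B * Real.exp (θ * u)) :
    LocallyIntegrableOn (fun t : ℝ => (w (-Real.log t) : ℂ)) (Set.Ioi 0) := by
  have hc : ContinuousOn (fun t : ℝ => B * t ^ (-θ)) (Set.Ioi 0) :=
    continuousOn_const.mul (continuousOn_id.rpow_const fun t ht => Or.inl (ne_of_gt ht))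
  rw [locallyIntegrableOn_iff isOpen_Ioi.isLocallyClosed]
  intro K hK hKc
  have hm : MeasurableSet K := hKc.measurableSet
  refine Integrable.mono' ((hc.mono hK).integrableOn_compact hKc)
    (measurable_comp_neg_log hw).aestronglyMeasurable ?_
  exact (ae_restrict_iff' hm).2 (Eventually.of_forall fun t ht => norm_comp_neg_log_le hb (hK ht))

/-- The Mellin transform of `t ↦ w (-log t)` is differentiable where it converges absolutely. -/
theorem mellin_comp_neg_log_hasDerivAt {w : ℝ → ℝ} {θ B : ℝ} (hw : Measurable w)
    (hb : ∀ u, |w u| ≤ B * Real.exp (θ * u)) (h0 : ∀ u < -1, w u = 0) {s : ℂ} (hs : θ < s.re) :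
    MellinConvergent (fun t : ℝ => (w (-Real.log t) : ℂ)) s ∧
      HasDerivAt (mellin fun t : ℝ => (w (-Real.log t) : ℂ))
        (mellin (fun t : ℝ => ((-(-Real.log t) * w (-Real.log t) : ℝ) : ℂ)) s) s := by
  have htop : (fun t : ℝ => (w (-Real.log t) : ℂ)) =O[atTop] (· ^ (-(s.re + 1))) := by
    refine (isBigO_zero _ _).congr' ?_ EventuallyEq.rfl
    filter_upwards [eventually_gt_atTop (Real.exp 1)] with t ht
    have : 1 < Real.log t := by
      rw [Real.lt_log_iff_exp_lt ((Real.exp_pos 1).trans ht)]; exact ht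
    rw [h0 _ (by linarith)]; simp
  have hbot : (fun t : ℝ => (w (-Real.log t) : ℂ)) =O[nhdsWithin 0 (Set.Ioi 0)] (· ^ (-θ)) := by
    refine IsBigO.of_bound B ?_
    filter_upwards [self_mem_nhdsWithin] with t ht
    rw [Real.norm_of_nonneg (Real.rpow_nonneg (le_of_lt ht) _)]
    exact norm_comp_neg_log_le hb ht
  have hli := locallyIntegrableOn_comp_neg_log hw hb
  refine ⟨mellinConvergent_of_isBigO_rpow hli htop (lt_add_one _) hbot hs, ?_⟩
  have hfun : (fun t : ℝ => ((-(-Real.log t) * w (-Real.log t) : ℝ) : ℂ)) =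
      fun t => Real.log t • (w (-Real.log t) : ℂ) := by
    funext t
    rw [neg_neg, Complex.real_smul, Complex.ofReal_mul]
  rw [hfun]
  exact (mellin_hasDerivAt_of_isBigO_rpow hli htop (lt_add_one _) hbot hs).2

open FourierTransform in
theorem mellin_comp_neg_log_meanSquare {w : ℝ → ℝ} {σ : ℝ}
    (h1 : Integrable fun u => w u * Real.exp (-σ * u))
    (h2 : Integrable fun u => w u ^ 2 * Real.exp (-(2 * σ) * u)) :
    Integrable (fun t : ℝ => ‖mellin (fun t : ℝ => (w (-Real.log t) : ℂ)) (σ + Complex.I * t)‖ ^ 2) ∧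
      ∀ T : ℝ, 0 ≤ T →
        ∫ t in (0 : ℝ)..T, ‖mellin (fun t : ℝ => (w (-Real.log t) : ℂ)) (σ + Complex.I * t)‖ ^ 2 ≤
          2 * Real.pi * ∫ u, w u ^ 2 * Real.exp (-(2 * σ) * u) := by
  set φ : ℝ → ℂ := fun u => ((w u * Real.exp (-σ * u) : ℝ) : ℂ) with hφ
  have hφ1 : Integrable φ := h1.ofReal
  have hsq : ∀ u, ‖φ u‖ ^ 2 = w u ^ 2 * Real.exp (-(2 * σ) * u) := fun u => by
    rw [hφ, Complex.norm_real, Real.norm_eq_abs, sq_abs, mul_pow, ← Real.exp_nat_mul]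
    congr 2
    push_cast
    ring
  have hφ2 : MemLp φ 2 := by
    rw [memLp_two_iff_integrable_sq_norm hφ1.1]
    simpa only [hsq] using h2
  have hmel : ∀ t : ℝ, mellin (fun t : ℝ => (w (-Real.log t) : ℂ)) (σ + Complex.I * t) =
      (𝓕 φ : ℝ → ℂ) ((2 * Real.pi)⁻¹ * t) := fun t => by
    have harg : (σ + Complex.I * t : ℂ).im / (2 * Real.pi) = (2 * Real.pi)⁻¹ * t := by
      simp [div_eq_inv_mul]
    have hfun : (fun u : ℝ => Real.exp (-(σ + Complex.I * t : ℂ).re * u) •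
        (w (-Real.log (Real.exp (-u))) : ℂ)) = φ := by
      funext u
      simp [hφ, mul_comm]
    rw [mellin_eq_fourier, harg, hfun]
  obtain ⟨hi, hp⟩ := plancherel_of_integrable hφ1 hφ2
  have hpi : (2 * Real.pi)⁻¹ ≠ 0 := by positivity
  simp only [hmel]
  have hi' := hi.comp_mul_left' hpi
  refine ⟨hi', fun T hT => ?_⟩
  rw [intervalIntegral.integral_of_le hT]
  calc _ ≤ ∫ t, ‖(𝓕 φ : ℝ → ℂ) ((2 * Real.pi)⁻¹ * t)‖ ^ 2 :=
        setIntegral_le_integral hi' (Eventually.of_forall fun t => by positivity)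
    _ = 2 * Real.pi * ∫ u, ‖φ u‖ ^ 2 := by
        rw [Measure.integral_comp_mul_left (fun ξ => ‖(𝓕 φ : ℝ → ℂ) ξ‖ ^ 2), hp, inv_inv,
          abs_of_pos Real.two_pi_pos, smul_eq_mul]
    _ = _ := by simp only [hsq]

theorem norm_mellin_le (f : ℝ → ℂ) (s : ℂ) :
    ‖mellin f s‖ ≤ ∫ t in Set.Ioi (0 : ℝ), t ^ (s.re - 1) * ‖f t‖ := by
  refine (norm_integral_le_integral_norm _).trans_eq ?_
  refine setIntegral_congr_fun measurableSet_Ioi fun t ht => ?_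
  simp only [norm_smul]
  rw [Complex.norm_cpow_eq_rpow_re_of_pos ht, Complex.sub_re, Complex.one_re]

theorem norm_le_mul_norm_exp_sub_one {σ t T : ℝ} (hσ : 0 ≤ σ) (ht : 0 ≤ t) (htT : t ≤ T)
    (hT : 0 < T) :
    ‖(σ + Complex.I * t : ℂ)‖ ≤
      3 * T * ‖Complex.exp ((1 / T : ℝ) * (σ + Complex.I * t)) - 1‖ := by
  set x := σ / T with hx
  set y := t / T with hy
  have hx0 : 0 ≤ x := by positivity
  have hy0 : 0 ≤ y := by positivity
  have hy1 : y ≤ 1 := by rw [hy, div_le_one hT]; exact htT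
  have hz : ((1 / T : ℝ) * (σ + Complex.I * t) : ℂ) = x + y * Complex.I := by
    rw [hx, hy]; push_cast; ring
  have hn : ‖(σ + Complex.I * t : ℂ)‖ ≤ T * (x + y) := by
    refine (norm_add_le _ _).trans_eq ?_
    rw [norm_mul, Complex.norm_I, Complex.norm_real, Complex.norm_real, Real.norm_of_nonneg hσ,
      Real.norm_of_nonneg ht, hx, hy]
    field_simp
  rw [hz]
  set W := ‖Complex.exp (x + y * Complex.I) - 1‖ with hW
  have h1 : x ≤ W := by
    have h := norm_sub_norm_le (Complex.exp (x + y * Complex.I)) 1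
    rw [Complex.norm_exp, norm_one] at h
    have := Real.add_one_le_exp x
    simp at h
    linarith
  have h2 : y ≤ 2 * W := by
    have h := Complex.abs_im_le_norm (Complex.exp (x + y * Complex.I) - 1)
    have him : (Complex.exp (x + y * Complex.I) - 1).im = Real.exp x * Real.sin y := by
      simp [Complex.exp_im]
    have hs := Real.mul_le_sin hy0 (by linarith [Real.pi_gt_three])
    have hpi : (1 : ℝ) / 2 ≤ 2 / Real.pi := by
      rw [div_le_div_iff₀ (by norm_num) Real.pi_pos]; linarith [Real.pi_le_four]
    have hs2 : y / 2 ≤ Real.sin y := by nlinarith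
    have hs3 : Real.sin y ≤ Real.exp x * Real.sin y :=
      le_mul_of_one_le_left (by linarith) (Real.one_le_exp hx0)
    rw [him] at h
    have := (le_abs_self _).trans h
    linarith
  nlinarith

namespace IsRemainder

variable {e : ℝ → ℝ} {θ A B : ℝ}

theorem mellin_sub_eq (h : IsRemainder e θ A B) {δ : ℝ} {s : ℂ} (hs : θ < s.re) :
    mellin (fun t : ℝ => ((e (-Real.log t + δ) - e (-Real.log t) : ℝ) : ℂ)) s =
      (Complex.exp (δ * s) - 1) * mellin (fun t : ℝ => (e (-Real.log t) : ℂ)) s := by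
  have hc := (mellin_comp_neg_log_hasDerivAt h.measurable h.abs_le
    (fun u hu => h.eq_zero u (by linarith)) hs).1
  set f : ℝ → ℂ := fun t : ℝ => (e (-Real.log t) : ℂ) with hf
  have hpos : 0 < Real.exp (-δ) := Real.exp_pos _
  have hsub := hasMellin_sub ((MellinConvergent.comp_mul_left hpos).2 hc) hc
  rw [mellin_comp_mul_left _ _ hpos] at hsub
  have hexp : ((Real.exp (-δ) : ℝ) : ℂ) ^ (-s) = Complex.exp (δ * s) := by
    rw [Complex.cpow_def_of_ne_zero (by exact_mod_cast hpos.ne'), ← Complex.ofReal_log hpos.le,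
      Real.log_exp]
    push_cast
    ring_nf
  rw [hexp] at hsub
  rw [sub_mul, one_mul, ← smul_eq_mul, ← hsub.2]
  refine setIntegral_congr_fun measurableSet_Ioi fun t ht => ?_
  simp only [hf]
  rw [Real.log_mul hpos.ne' (ne_of_gt ht), Real.log_exp]
  push_cast
  ring_nf

theorem exp_sub_one_mul_mellin_deriv (h : IsRemainder e θ A B) (hθ : θ ≤ 1) {δ : ℝ} (hδ0 : 0 ≤ δ)
    (hδ1 : δ ≤ 1) {s : ℂ} (hs : θ < s.re) :
    (Complex.exp (δ * s) - 1) *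
        mellin (fun t : ℝ => ((-(-Real.log t) * e (-Real.log t) : ℝ) : ℂ)) s =
      mellin (fun t : ℝ =>
        ((-(-Real.log t) * (e (-Real.log t + δ) - e (-Real.log t)) : ℝ) : ℂ)) s -
      δ * Complex.exp (δ * s) * mellin (fun t : ℝ => (e (-Real.log t) : ℂ)) s := by
  have hF := (mellin_comp_neg_log_hasDerivAt h.measurable h.abs_le
    (fun u hu => h.eq_zero u (by linarith)) hs).2
  have hD := (mellin_comp_neg_log_hasDerivAt (w := fun u => e (u + δ) - e u)
    (by have := h.measurable; fun_prop) (h.abs_sub_le hθ hδ0 hδ1)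
    (fun u hu => h.sub_eq_zero_of_lt hδ0 (by linarith)) hs).2
  have hexp : HasDerivAt (fun z : ℂ => Complex.exp (δ * z) - 1) (Complex.exp (δ * s) * δ) s := by
    have := ((hasDerivAt_id s).const_mul (δ : ℂ)).cexp.sub_const 1
    simpa using this
  have hopen : IsOpen {z : ℂ | θ < z.re} := isOpen_lt continuous_const Complex.continuous_re
  have heq : (mellin fun t : ℝ => ((e (-Real.log t + δ) - e (-Real.log t) : ℝ) : ℂ)) =ᶠ[nhds s]
      fun z => (Complex.exp (δ * z) - 1) * mellin (fun t : ℝ => (e (-Real.log t) : ℂ)) z := by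
    filter_upwards [hopen.mem_nhds hs] with z hz
    exact h.mellin_sub_eq hz
  have := hD.unique ((hexp.mul hF).congr_of_eventuallyEq heq)
  rw [this]
  ring

end IsRemainder

theorem inv_mul_integral_norm_sq_le {P G : ℝ → ℂ} {T M K : ℝ} (hT : 0 < T)
    (hP : ∀ t, 0 ≤ t → t ≤ T → ‖P t‖ ≤ 3 * T * ‖G t‖ + M)
    (hG : Integrable fun t => ‖G t‖ ^ 2) (hK : ∫ t in (0 : ℝ)..T, ‖G t‖ ^ 2 ≤ K * (1 / T)) :
    (1 / T) * ∫ t in (0 : ℝ)..T, ‖P t‖ ^ 2 ≤ 18 * K + 2 * M ^ 2 := by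
  have hle : ∫ t in (0 : ℝ)..T, ‖P t‖ ^ 2 ≤
      ∫ t in (0 : ℝ)..T, (18 * T ^ 2 * ‖G t‖ ^ 2 + 2 * M ^ 2) := by
    rw [intervalIntegral.integral_of_le hT.le, intervalIntegral.integral_of_le hT.le]
    refine integral_mono_of_nonneg (Eventually.of_forall fun t => by positivity)
      ((hG.const_mul _).integrableOn.add (integrableOn_const (by simp))) ?_
    refine (ae_restrict_iff' measurableSet_Ioc).2 (Eventually.of_forall fun t ht => ?_)
    have h1 := hP t ht.1.le ht.2
    have h2 : ‖P t‖ ^ 2 ≤ (3 * T * ‖G t‖ + M) ^ 2 := by gcongr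
    have h3 := sq_nonneg (3 * T * ‖G t‖ - M)
    beta_reduce
    nlinarith
  rw [intervalIntegral.integral_add (hG.const_mul _).intervalIntegrable intervalIntegrable_const,
    intervalIntegral.integral_const_mul, intervalIntegral.integral_const, smul_eq_mul,
    sub_zero] at hle
  rw [one_div, inv_mul_le_iff₀ hT]
  have h2 : 18 * T ^ 2 * ∫ t in (0 : ℝ)..T, ‖G t‖ ^ 2 ≤ 18 * T ^ 2 * (K * (1 / T)) := by gcongr
  have h3 : 18 * T ^ 2 * (K * (1 / T)) = T * (18 * K) := by field_simp
  linarith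

namespace BeurlingSystem

variable (S : BeurlingSystem)

theorem one_lt_p' (j : ℕ) : 1 < S.p j := S.one_lt_p.trans_le (S.mono_p j.zero_le)

theorem one_le_n (j : ℕ) : 1 ≤ S.n j := by
  rw [← S.equiv.apply_symm_apply j, S.n_eq]
  exact Finset.one_le_prod fun i _ => one_le_pow₀ (S.one_lt_p' i).le

theorem finite_setOf_n_le (x : ℝ) : {j | S.n j ≤ x}.Finite := by
  obtain ⟨J, hJ⟩ := (S.tendsto_p.eventually_gt_atTop x).exists
  obtain ⟨M, hM⟩ := pow_unbounded_of_one_lt x S.one_lt_p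
  set m : ℕ →₀ ℕ := ∑ j ∈ Finset.range J, Finsupp.single j M with hm
  have hsub : {j | S.n j ≤ x} ⊆ S.equiv '' Set.Icc 0 m := by
    intro j hj
    refine ⟨S.equiv.symm j, ⟨zero_le, fun i => ?_⟩, S.equiv.apply_symm_apply j⟩
    set k := S.equiv.symm j
    by_cases hi : i ∈ k.support
    · have hjx : S.n j ≤ x := hj
      rw [← S.equiv.apply_symm_apply j, S.n_eq, ← Finset.mul_prod_erase _ _ hi] at hjx
      have hpow : S.p i ^ k i ≤ x := (le_mul_of_one_le_right
        (pow_nonneg (zero_le_one.trans (S.one_lt_p' i).le) _)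
        (Finset.one_le_prod fun i _ => one_le_pow₀ (S.one_lt_p' i).le)).trans hjx
      have hiJ : i < J := by
        by_contra! h
        have h1 : S.p i ≤ S.p i ^ k i :=
          le_self_pow₀ (S.one_lt_p' i).le (Finsupp.mem_support_iff.1 hi)
        linarith [S.mono_p h]
      have hkM : k i ≤ M := by
        by_contra! h
        have h1 : S.p 0 ^ k i ≤ S.p i ^ k i := by
          have := S.one_lt_p
          gcongr
          exact S.mono_p i.zero_le
        have h2 : S.p 0 ^ M ≤ S.p 0 ^ k i := pow_le_pow_right₀ S.one_lt_p.le h.le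
        linarith
      have : m i = M := by
        simp [hm, Finsupp.finsetSum_apply, Finsupp.single_apply, hiJ]
      rwa [this]
    · rw [Finsupp.notMem_support_iff.1 hi]
      exact Nat.zero_le _
  exact ((Set.finite_Icc 0 m).image _).subset hsub

theorem Nint_mono : Monotone S.Nint := fun _ y hxy =>
  Set.ncard_le_ncard (fun _ hj => le_trans hj hxy) (S.finite_setOf_n_le y)

theorem Nint_eq_zero {x : ℝ} (hx : x < 1) : S.Nint x = 0 := by
  rw [Nint, Set.ncard_eq_zero (S.finite_setOf_n_le x)]
  ext j
  simpa using hx.trans_le (S.one_le_n j)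

theorem lt_Nint (j : ℕ) : j < S.Nint (S.n j) := by
  have h : (Finset.range (j + 1) : Set ℕ) ⊆ {i | S.n i ≤ S.n j} := fun i hi =>
    S.mono_n (Nat.lt_succ_iff.1 (Finset.mem_range.1 hi))
  have := Set.ncard_le_ncard h (S.finite_setOf_n_le _)
  rw [Set.ncard_coe_finset, Finset.card_range] at this
  exact this

theorem hasSum_ite_n_le (x : ℝ) (z : ℂ) :
    HasSum (fun j => if S.n j ≤ x then z else 0) (S.Nint x * z) := by
  have hfin := S.finite_setOf_n_le x
  have h := hasSum_sum_of_ne_finset_zero (L := .unconditional ℕ) (f := fun j => if S.n j ≤ x then z else 0)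
    (s := hfin.toFinset) fun j hj => if_neg (by simpa using hj)
  rw [Finset.sum_congr rfl fun j hj => if_pos (by simpa using hj), Finset.sum_const,
    nsmul_eq_mul, ← Set.ncard_eq_toFinset_card _ hfin] at h
  exact h

/-- The normalised remainder `N(e ^ u) - A e ^ u` of the integers, extended by `0` to `u < 0`. -/
noncomputable def remainder (A : ℝ) (u : ℝ) : ℝ :=
  if 0 ≤ u then S.Nint (Real.exp u) - A * Real.exp u else 0

theorem exists_abs_Nint_sub_le {θ A : ℝ} (hθ0 : 0 ≤ θ) (hA : 0 < A)
    (hwb : (fun x : ℝ => (S.Nint x : ℝ) - A * x) =O[atTop] fun x : ℝ => x ^ θ) :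
    ∃ B, ∀ x, 1 ≤ x → |S.Nint x - A * x| ≤ B * x ^ θ := by
  obtain ⟨B, hB⟩ := hwb.bound
  obtain ⟨x₀, hx₀⟩ := eventually_atTop.1 hB
  refine ⟨max B (S.Nint x₀ + A * x₀), fun x hx => ?_⟩
  have hpow : 1 ≤ x ^ θ := Real.one_le_rpow hx hθ0
  rcases le_total x₀ x with h | h
  · have := hx₀ x h
    rw [Real.norm_eq_abs, Real.norm_of_nonneg (by linarith)] at this
    refine this.trans ?_
    gcongr
    exact le_max_left _ _
  · have hN : (S.Nint x : ℝ) ≤ S.Nint x₀ := by exact_mod_cast S.Nint_mono h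
    have hN0 : (0 : ℝ) ≤ S.Nint x := by positivity
    have hAx : A * x ≤ A * x₀ := by gcongr
    have hAx0 : 0 ≤ A * x := by positivity
    have h1 : |S.Nint x - A * x| ≤ S.Nint x₀ + A * x₀ := abs_le.2 ⟨by linarith, by linarith⟩
    have h2 : 0 ≤ S.Nint x₀ + A * x₀ := (abs_nonneg _).trans h1
    calc _ ≤ max B (S.Nint x₀ + A * x₀) * 1 := by
          rw [mul_one]; exact h1.trans (le_max_right _ _)
      _ ≤ _ := by
          gcongr

theorem isRemainder {θ A B : ℝ} (hB : ∀ x, 1 ≤ x → |S.Nint x - A * x| ≤ B * x ^ θ) :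
    IsRemainder (S.remainder A) θ A B where
  measurable := by
    have h : Measurable fun x => (S.Nint x : ℝ) :=
      (Nat.mono_cast.comp S.Nint_mono).measurable
    exact Measurable.ite measurableSet_Ici ((h.comp Real.measurable_exp).sub (by fun_prop)) measurable_const
  eq_zero u hu := if_neg (not_le.2 hu)
  abs_le u := by
    have hB0 : 0 ≤ B := by simpa using (abs_nonneg _).trans (hB 1 le_rfl)
    rw [remainder]
    split_ifs with hu
    · have := hB _ (Real.one_le_exp hu)
      rwa [← Real.exp_mul, mul_comm u] at this
    · rw [abs_zero]; positivity
  mono u v hu huv := by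
    have : (S.Nint (Real.exp u) : ℝ) ≤ S.Nint (Real.exp v) := by
      exact_mod_cast S.Nint_mono (Real.exp_le_exp.2 huv)
    rw [remainder, remainder, if_pos hu, if_pos (hu.trans huv)]
    linarith

theorem exists_Nint_le {θ A B : ℝ} (hθ1 : θ ≤ 1) (hA : 0 < A)
    (hB : ∀ x, 1 ≤ x → |S.Nint x - A * x| ≤ B * x ^ θ) :
    ∃ K, 0 < K ∧ ∀ x, 1 ≤ x → S.Nint x ≤ K * x := by
  have hB0 : 0 ≤ B := by simpa using (abs_nonneg _).trans (hB 1 le_rfl)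
  refine ⟨A + B, by positivity, fun x hx => ?_⟩
  have h1 := (abs_le.1 (hB x hx)).2
  have h2 : B * x ^ θ ≤ B * x ^ (1 : ℝ) := by gcongr
  rw [Real.rpow_one] at h2
  linarith

theorem summable_n_rpow {K σ : ℝ} (hK0 : 0 < K) (hK : ∀ x, 1 ≤ x → S.Nint x ≤ K * x)
    (hσ : 1 < σ) : Summable fun j => S.n j ^ (-σ) := by
  have h1 : Summable fun j : ℕ => K ^ σ * ((j + 1 : ℕ) : ℝ) ^ (-σ) :=
    ((summable_nat_add_iff 1).2 (Real.summable_nat_rpow.2 (by linarith))).mul_left _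
  refine h1.of_nonneg_of_le (fun j => Real.rpow_nonneg (zero_le_one.trans (S.one_le_n j)) _)
    fun j => ?_
  have h2 : ((j + 1 : ℕ) : ℝ) ≤ K * S.n j :=
    le_trans (by exact_mod_cast S.lt_Nint j) (hK _ (S.one_le_n j))
  have h3 := Real.rpow_le_rpow_of_nonpos (z := -σ) (by positivity) h2 (by linarith)
  rw [Real.mul_rpow hK0.le (zero_le_one.trans (S.one_le_n j))] at h3
  calc S.n j ^ (-σ) = K ^ σ * (K ^ (-σ) * S.n j ^ (-σ)) := by
        rw [← mul_assoc, ← Real.rpow_add hK0, add_neg_cancel, Real.rpow_zero, one_mul]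
    _ ≤ _ := by gcongr

end BeurlingSystem

namespace BeurlingSystem

variable (S : BeurlingSystem)

theorem remainder_neg_log (A : ℝ) {t : ℝ} (ht : 0 < t) :
    (S.Nint t⁻¹ : ℂ) = S.remainder A (-Real.log t) +
      (A : ℂ) * (Set.Ioc (0 : ℝ) 1).indicator (fun t => (t : ℂ) ^ (-1 : ℂ)) t := by
  rw [remainder]
  by_cases h : t ≤ 1
  · rw [if_pos (neg_nonneg.2 (Real.log_nonpos ht.le h)), 
      Set.indicator_of_mem (show t ∈ Set.Ioc (0 : ℝ) 1 from ⟨ht, h⟩),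
      Real.exp_neg, Real.exp_log ht, Complex.cpow_neg_one]
    push_cast
    ring
  · have h1 : 0 < Real.log t := Real.log_pos (not_le.1 h)
    rw [if_neg (by linarith), Set.indicator_of_notMem (fun hh => h hh.2),
      S.Nint_eq_zero (inv_lt_one_of_one_lt₀ (not_le.1 h))]
    simp

theorem hasMellin_indicator_le_inv {b : ℝ} (hb : 0 < b) {s : ℂ} (hs : 0 < s.re) :
    HasMellin (fun t : ℝ => if b ≤ t⁻¹ ∧ 0 < t then (1 : ℂ) else 0) s ((b : ℂ) ^ (-s) / s) := by
  have h := hasMellin_one_Ioc hs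
  set g : ℝ → ℂ := Set.indicator (Set.Ioc (0 : ℝ) 1) fun _ => 1 with hg
  have heq : (fun t : ℝ => if b ≤ t⁻¹ ∧ 0 < t then (1 : ℂ) else 0) = fun t => g (b * t) := by
    funext t
    have : (b ≤ t⁻¹ ∧ 0 < t) ↔ b * t ∈ Set.Ioc (0 : ℝ) 1 := by
      rw [Set.mem_Ioc, mul_pos_iff_of_pos_left hb, and_comm]
      refine and_congr_right fun ht => ?_
      rw [← le_div_iff₀ ht, one_div]
    rw [hg, Set.indicator_apply]
    simp only [this]
  rw [heq]
  refine ⟨(MellinConvergent.comp_mul_left hb).2 h.1, ?_⟩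
  rw [mellin_comp_mul_left _ _ hb, h.2, smul_eq_mul, mul_one_div]

theorem tsum_n_cpow_eq {θ A B : ℝ} (hθ1 : θ < 1) (hA : 0 < A)
    (hB : ∀ x, 1 ≤ x → |S.Nint x - A * x| ≤ B * x ^ θ) {s : ℂ} (hs : 1 < s.re) :
    ∑' j, (S.n j : ℂ) ^ (-s) =
      s * mellin (fun t : ℝ => (S.remainder A (-Real.log t) : ℂ)) s + A * s / (s - 1) := by
  obtain ⟨K, hK0, hK⟩ := S.exists_Nint_le hθ1.le hA hB
  have hn : ∀ j, 0 < S.n j := fun j => zero_lt_one.trans_le (S.one_le_n j)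
  have hs0 : s ≠ 0 := fun h => by rw [h, Complex.zero_re] at hs; linarith
  have hs1 : s - 1 ≠ 0 := fun h => by
    rw [sub_eq_zero.1 h, Complex.one_re] at hs; linarith
  set χ : ℕ → ℝ → ℂ := fun j t => if S.n j ≤ t⁻¹ ∧ 0 < t then (1 : ℂ) else 0 with hχ
  have hM : ∀ j, HasMellin (χ j) s ((S.n j : ℂ) ^ (-s) / s) := fun j =>
    hasMellin_indicator_le_inv (hn j) (by linarith)
  have hnorm : ∀ j, ∫ t in Set.Ioi (0 : ℝ), ‖(t : ℂ) ^ (s - 1) • χ j t‖ =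
      S.n j ^ (-s.re) / s.re := fun j => by
    have h := (hasMellin_indicator_le_inv (hn j) (s := s.re)
      (by rw [Complex.ofReal_re]; linarith)).2
    rw [mellin] at h
    have h2 : ∫ t in Set.Ioi (0 : ℝ), (t : ℂ) ^ ((s.re : ℂ) - 1) • χ j t =
        ((∫ t in Set.Ioi (0 : ℝ), ‖(t : ℂ) ^ (s - 1) • χ j t‖ : ℝ) : ℂ) := by
      rw [← integral_complex_ofReal]
      refine setIntegral_congr_fun measurableSet_Ioi fun t ht => ?_
      have ht0 : 0 < t := ht
      rw [norm_smul, Complex.norm_cpow_eq_rpow_re_of_pos ht0, Complex.sub_re, Complex.one_re,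
        Complex.ofReal_mul, Complex.ofReal_cpow ht0.le]
      simp only [hχ]
      split_ifs <;> simp
    rw [h2] at h
    have h3 : ((S.n j ^ (-s.re) / s.re : ℝ) : ℂ) = (S.n j : ℂ) ^ (-(s.re : ℂ)) / s.re := by
      push_cast [Complex.ofReal_cpow (hn j).le]
      rfl
    rw [← h3] at h
    exact Complex.ofReal_injective h
  have hsum := hasSum_integral_of_summable_integral_norm
    (μ := volume.restrict (Set.Ioi (0 : ℝ))) (F := fun j t => (t : ℂ) ^ (s - 1) • χ j t)
    (fun j => (hM j).1) (by
      simp only [hnorm]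
      exact (S.summable_n_rpow hK0 hK hs).div_const _)
  have hF := (mellin_comp_neg_log_hasDerivAt (S.isRemainder hB).measurable (S.isRemainder hB).abs_le
    (fun u hu => (S.isRemainder hB).eq_zero u (by linarith)) (hθ1.trans hs)).1
  have hI := hasMellin_cpow_Ioc (-1) (s := s) (by simp; linarith)
  have hI2 := hasMellin_const_smul hI.1 (A : ℂ)
  have hadd := hasMellin_add hF hI2.1
  have hval : ∫ t in Set.Ioi (0 : ℝ), ∑' j, (t : ℂ) ^ (s - 1) • χ j t =
      mellin (fun t : ℝ => (S.remainder A (-Real.log t) : ℂ)) s + A / (s - 1) := by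
    have h1 : (A : ℂ) / (s - 1) = (A : ℂ) • (1 / (s + -1)) := by
      rw [smul_eq_mul, mul_one_div, sub_eq_add_neg]
    rw [h1, ← hI.2, ← hI2.2, ← hadd.2, mellin]
    refine setIntegral_congr_fun measurableSet_Ioi fun t ht => ?_
    have ht0 : 0 < t := ht
    have h2 := (S.hasSum_ite_n_le t⁻¹ 1).tsum_eq
    simp only [smul_eq_mul, hχ, ht0, and_true]
    rw [tsum_mul_left, h2, mul_one, S.remainder_neg_log A ht0]
  rw [hval] at hsum
  have h3 := (hsum.mul_left s).tsum_eq
  have h4 : ∀ j, s * ∫ t in Set.Ioi (0 : ℝ), (t : ℂ) ^ (s - 1) • χ j t = (S.n j : ℂ) ^ (-s) := by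
    intro j
    rw [show ∫ t in Set.Ioi (0 : ℝ), (t : ℂ) ^ (s - 1) • χ j t = _ from (hM j).2]
    field_simp
  simp only [h4] at h3
  rw [h3]
  ring

/-- The analytic continuation of the zeta function through the Mellin transform of the
remainder. -/
theorem IsZeta.sub_eq {S : BeurlingSystem} {θ A B : ℝ} {Z : ℂ → ℂ} (hZ : S.IsZeta θ A Z)
    (hθ1 : θ < 1) (hA : 0 < A) (hB : ∀ x, 1 ≤ x → |S.Nint x - A * x| ≤ B * x ^ θ)
    {s : ℂ} (hs : θ < s.re) :
    Z s - A / (s - 1) =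
      s * mellin (fun t : ℝ => (S.remainder A (-Real.log t) : ℂ)) s + A := by
  have hopen : IsOpen {z : ℂ | θ < z.re} := isOpen_lt continuous_const Complex.continuous_re
  have hF : DifferentiableOn ℂ
      (fun s => s * mellin (fun t : ℝ => (S.remainder A (-Real.log t) : ℂ)) s + A)
      {z : ℂ | θ < z.re} := fun z hz =>
    ((differentiableAt_id.mul (mellin_comp_neg_log_hasDerivAt (S.isRemainder hB).measurable
      (S.isRemainder hB).abs_le (fun u hu => (S.isRemainder hB).eq_zero u (by linarith))
      hz).2.differentiableAt).add_const _).differentiableWithinAt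
  have hconv : IsPreconnected {z : ℂ | θ < z.re} :=
    (convex_halfSpace_re_gt θ).isPreconnected
  refine (hZ.2.analyticOnNhd hopen).eqOn_of_preconnected_of_eventuallyEq
    (hF.analyticOnNhd hopen) hconv (z₀ := 2) (by simp; linarith) ?_ hs
  have hopen1 : IsOpen {z : ℂ | 1 < z.re} := isOpen_lt continuous_const Complex.continuous_re
  filter_upwards [hopen1.mem_nhds (show (1 : ℝ) < (2 : ℂ).re by simp)] with z hz
  have hz1 : z - 1 ≠ 0 := fun h => by
    have hz' : 1 < z.re := hz
    rw [sub_eq_zero.1 h, Complex.one_re] at hz'; linarith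
  rw [hZ.1 z hz, S.tsum_n_cpow_eq hθ1 hA hB hz]
  field_simp
  ring

theorem IsZeta.hasDerivAt {S : BeurlingSystem} {θ A B : ℝ} {Z : ℂ → ℂ} (hZ : S.IsZeta θ A Z)
    (hθ1 : θ < 1) (hA : 0 < A) (hB : ∀ x, 1 ≤ x → |S.Nint x - A * x| ≤ B * x ^ θ)
    {s : ℂ} (hs : θ < s.re) (hs1 : s ≠ 1) :
    HasDerivAt Z (mellin (fun t : ℝ => (S.remainder A (-Real.log t) : ℂ)) s +
      s * mellin (fun t : ℝ => ((-(-Real.log t) * S.remainder A (-Real.log t) : ℝ) : ℂ)) s -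
      A / (s - 1) ^ 2) s := by
  have hopen : IsOpen {z : ℂ | θ < z.re} := isOpen_lt continuous_const Complex.continuous_re
  have hF := (mellin_comp_neg_log_hasDerivAt (S.isRemainder hB).measurable
      (S.isRemainder hB).abs_le (fun u hu => (S.isRemainder hB).eq_zero u (by linarith)) hs).2
  have hs1' : s - 1 ≠ 0 := sub_ne_zero.2 hs1
  have hinv : HasDerivAt (fun z : ℂ => (A : ℂ) / (z - 1)) (-A / (s - 1) ^ 2) s := by
    have := (hasDerivAt_const s (A : ℂ)).div ((hasDerivAt_id s).sub_const 1) hs1'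
    refine this.congr_deriv ?_
    simp
  have h := (((hasDerivAt_id s).mul hF).add_const (A : ℂ)).add hinv
  have heq : Z =ᶠ[nhds s] fun z =>
      (z * mellin (fun t : ℝ => (S.remainder A (-Real.log t) : ℂ)) z + A) + A / (z - 1) := by
    filter_upwards [hopen.mem_nhds hs] with z hz
    rw [← hZ.sub_eq hθ1 hA hB hz]
    ring
  refine (h.congr_of_eventuallyEq heq).congr_deriv ?_
  simp only [id]
  ring

end BeurlingSystem

theorem IsRemainder.exists_mellin_meanSquare_le {e : ℝ → ℝ} {θ A B : ℝ}
    (h : IsRemainder e θ A B) (hA : 0 ≤ A) (hθ0 : 0 ≤ θ) (hθ : θ < 1) (k : ℕ) :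
    ∃ C, 0 ≤ C ∧ ∀ T : ℝ, 2 ≤ T → ∀ (P : ℝ → ℂ) (M : ℝ),
      (∀ t, 0 ≤ t → t ≤ T → ‖P t‖ ≤ 3 * T * ‖mellin (fun x : ℝ => (((-(-Real.log x)) ^ k *
        (e (-Real.log x + 1 / T) - e (-Real.log x)) : ℝ) : ℂ))
          (((1 + θ) / 2 : ℝ) + Complex.I * t)‖ + M) →
      (1 / T) * ∫ t in (0 : ℝ)..T, ‖P t‖ ^ 2 ≤
        (C + 2 ^ (2 * k + 2) * M ^ 2) * Real.log T ^ (2 * k + 1) := by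
  obtain ⟨C, hC0, hC⟩ := h.exists_integral_sq_le hA hθ0 hθ (2 * k)
  refine ⟨18 * (2 * Real.pi * C), by positivity, fun T hT P M hP => ?_⟩
  have hT0 : 0 < T := by linarith
  have hδ0 : 0 ≤ 1 / T := by positivity
  have hδ1 : 1 / T < 1 := by rw [div_lt_one hT0]; linarith
  set δ := 1 / T with hδ
  have h2σ : 2 * ((1 + θ) / 2) = 1 + θ := by ring
  have hsq : ∀ u, ((-u) ^ k * (e (u + δ) - e u)) ^ 2 * Real.exp (-(2 * ((1 + θ) / 2)) * u) =
      |u| ^ (2 * k) * (e (u + δ) - e u) ^ 2 * Real.exp (-(1 + θ) * u) := fun u => by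
    rw [h2σ, mul_pow, ← pow_mul, mul_comm k, pow_mul, neg_sq, pow_mul |u|, sq_abs]
  have h1 : Integrable fun u => (-u) ^ k * (e (u + δ) - e u) * Real.exp (-((1 + θ) / 2) * u) := by
    refine ((h.integrable_pow_mul hθ.le hδ0 hδ1 (r := (1 + θ) / 2) (by linarith) k).const_mul
      ((-1) ^ k)).congr (Eventually.of_forall fun u => ?_)
    beta_reduce
    rw [neg_pow u]
    ring
  have h2 := (h.integrable_pow_mul_sq hθ hδ0 hδ1 (2 * k)).congr
    (Eventually.of_forall fun u => (hsq u).symm)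
  obtain ⟨hi, hle⟩ := mellin_comp_neg_log_meanSquare
    (w := fun u => (-u) ^ k * (e (u + δ) - e u)) h1 h2
  have hle' := hle T hT0.le
  simp only [hsq] at hle'
  have hL : 1 ≤ 2 * Real.log T := by
    have : Real.log 2 ≤ Real.log T := Real.log_le_log (by norm_num) hT
    linarith [Real.log_two_gt_d9]
  refine (inv_mul_integral_norm_sq_le (K := 2 * Real.pi * C * Real.log T ^ (2 * k + 1)) hT0 hP hi
    (hle'.trans ?_)).trans ?_
  · have := mul_le_mul_of_nonneg_left (hC T hT) Real.two_pi_pos.le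
    refine this.trans_eq ?_
    ring
  · have hp : 1 ≤ 2 ^ (2 * k + 1) * Real.log T ^ (2 * k + 1) := by
      rw [← mul_pow]; exact one_le_pow₀ hL
    have : 2 * M ^ 2 * 1 ≤ 2 * M ^ 2 * (2 ^ (2 * k + 1) * Real.log T ^ (2 * k + 1)) := by gcongr
    calc _ ≤ 18 * (2 * Real.pi * C * Real.log T ^ (2 * k + 1)) +
          2 * M ^ 2 * (2 ^ (2 * k + 1) * Real.log T ^ (2 * k + 1)) := by linarith
      _ = _ := by rw [pow_succ 2 (2 * k + 1)]; ring

/-- Theorem 2.4: second moment estimates for the Beurling zeta function and its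
derivative on the line `Re s = (1+θ)/2`. -/
theorem second_moment_zeta
    (θ : ℝ) (hθ0 : 0 ≤ θ) (hθ1 : θ < 1) (S : BeurlingSystem)
    (A : ℝ) (hA : 0 < A)
    (hwb : (fun x : ℝ => (S.Nint x : ℝ) - A * x) =O[atTop] fun x : ℝ => x ^ θ)
    (Z : ℂ → ℂ) (hZ : S.IsZeta θ A Z) :
    ∃ C : ℝ, ∀ T : ℝ, 2 ≤ T →
      (1 / T) * (∫ t in (0:ℝ)..T,
          ‖Z ((((1 + θ) / 2 : ℝ) : ℂ) + Complex.I * (t : ℂ))‖ ^ 2)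
        ≤ C * Real.log T ∧
      (1 / T) * (∫ t in (0:ℝ)..T,
          ‖deriv Z ((((1 + θ) / 2 : ℝ) : ℂ) + Complex.I * (t : ℂ))‖ ^ 2)
        ≤ C * Real.log T ^ 3 := by
  obtain ⟨B, hB⟩ := S.exists_abs_Nint_sub_le hθ0 hA hwb
  have h := S.isRemainder hB
  obtain ⟨C₀, hC₀, h0⟩ := h.exists_mellin_meanSquare_le hA.le hθ0 hθ1 0
  obtain ⟨C₁, hC₁, h1⟩ := h.exists_mellin_meanSquare_le hA.le hθ0 hθ1 1
  set σ := (1 + θ) / 2 with hσ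
  set c := 1 - σ with hc
  have hσ0 : 0 ≤ σ := by rw [hσ]; linarith
  have hσ1 : σ ≤ 1 := by rw [hσ]; linarith
  have hc0 : 0 < c := by rw [hc, hσ]; linarith
  set F := mellin (fun t : ℝ => (S.remainder A (-Real.log t) : ℂ)) with hF
  set M := ∫ t in Set.Ioi (0 : ℝ), t ^ (σ - 1) * ‖(S.remainder A (-Real.log t) : ℂ)‖
  set M₀ := A + A / c
  set M₁ := 10 * M + A / c ^ 2 with hM₁
  have hre : ∀ t : ℝ, (σ + Complex.I * t : ℂ).re = σ := fun t => by simp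
  have hθs : ∀ t : ℝ, θ < (σ + Complex.I * t : ℂ).re := fun t => by rw [hre, hσ]; linarith
  have hs1 : ∀ t : ℝ, c ≤ ‖(σ + Complex.I * t : ℂ) - 1‖ := fun t => by
    have := (neg_le_abs _).trans (Complex.abs_re_le_norm ((σ + Complex.I * t : ℂ) - 1))
    rw [Complex.sub_re, hre, Complex.one_re] at this
    linarith
  have hFM : ∀ t : ℝ, ‖F (σ + Complex.I * t)‖ ≤ M := fun t => by
    have := norm_mellin_le (fun t : ℝ => (S.remainder A (-Real.log t) : ℂ)) (σ + Complex.I * t)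
    rwa [hre] at this
  have hM : 0 ≤ M := (norm_nonneg _).trans (hFM 0)
  refine ⟨max (C₀ + 2 ^ (2 * 0 + 2) * M₀ ^ 2) (C₁ + 2 ^ (2 * 1 + 2) * M₁ ^ 2), fun T hT => ?_⟩
  have hT0 : 0 < T := by linarith
  have hL : 0 ≤ Real.log T := Real.log_nonneg (by linarith)
  have hδ0 : 0 ≤ 1 / T := by positivity
  have hδ1 : 1 / T ≤ 1 := by rw [div_le_one hT0]; linarith
  constructor
  · refine (h0 T hT (fun t => Z (σ + Complex.I * t)) M₀ fun t ht htT => ?_).trans ?_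
    · have hz := hZ.sub_eq hθ1 hA hB (hθs t)
      rw [sub_eq_iff_eq_add] at hz
      simp only [pow_zero, one_mul]
      rw [h.mellin_sub_eq (hθs t), hz, ← hF, norm_mul]
      have hn := norm_le_mul_norm_exp_sub_one hσ0 ht htT hT0
      have e1 : ‖(A : ℂ)‖ = A := by rw [Complex.norm_real, Real.norm_of_nonneg hA.le]
      have e2 : ‖(A : ℂ) / ((σ + Complex.I * t : ℂ) - 1)‖ ≤ A / c := by
        rw [norm_div, e1]
        gcongr
        exact hs1 t
      have e3 := mul_le_mul_of_nonneg_right hn (norm_nonneg (F (σ + Complex.I * t)))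
      refine (norm_add_le _ _).trans ?_
      have e4 := norm_add_le ((σ + Complex.I * t : ℂ) * F (σ + Complex.I * t)) (A : ℂ)
      rw [norm_mul, e1] at e4
      linarith
    · rw [mul_zero, zero_add, pow_one]
      gcongr
      exact le_max_left _ _
  · refine (h1 T hT (fun t => deriv Z (σ + Complex.I * t)) M₁ fun t ht htT => ?_).trans ?_
    · have hne : (σ + Complex.I * t : ℂ) ≠ 1 := fun hh => by
        have := hs1 t
        rw [hh, sub_self, norm_zero] at this
        linarith
      have hd := h.exp_sub_one_mul_mellin_deriv hθ1.le hδ0 hδ1 (hθs t)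
      rw [(hZ.hasDerivAt hθ1 hA hB (hθs t) hne).deriv]
      simp only [pow_one]
      rw [← hF] at hd ⊢
      set F1 := mellin (fun t : ℝ =>
        ((-(-Real.log t) * S.remainder A (-Real.log t) : ℝ) : ℂ)) (σ + Complex.I * t)
      set s := (σ + Complex.I * t : ℂ) with hs
      set D := mellin (fun t : ℝ => ((-(-Real.log t) *
        (S.remainder A (-Real.log t + 1 / T) - S.remainder A (-Real.log t)) : ℝ) : ℂ)) s
      have hn := norm_le_mul_norm_exp_sub_one hσ0 ht htT hT0
      have e1 : ‖(A : ℂ) / (s - 1) ^ 2‖ ≤ A / c ^ 2 := by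
        rw [norm_div, Complex.norm_real, Real.norm_of_nonneg hA.le, norm_pow]
        gcongr
        exact hs1 t
      have e2 : ‖Complex.exp ((1 / T : ℝ) * s)‖ ≤ 3 := by
        rw [Complex.norm_exp, Complex.re_ofReal_mul, hre]
        calc Real.exp (1 / T * σ) ≤ Real.exp 1 := by
              gcongr; exact mul_le_one₀ hδ1 hσ0 hσ1
          _ ≤ 3 := by linarith [Real.exp_one_lt_d9]
      have e3 : ‖((1 / T : ℝ) : ℂ) * Complex.exp ((1 / T : ℝ) * s) * F s‖ ≤ 1 / T * 3 * M := by
        rw [norm_mul, norm_mul, Complex.norm_real, Real.norm_of_nonneg hδ0]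
        gcongr
        exact hFM t
      have e4 : ‖s * F1‖ ≤ 3 * T * ‖D‖ + 9 * M := by
        calc ‖s * F1‖ ≤ 3 * T * ‖(Complex.exp ((1 / T : ℝ) * s) - 1) * F1‖ := by
              rw [norm_mul, norm_mul, ← mul_assoc]
              gcongr
          _ ≤ 3 * T * (‖D‖ + 1 / T * 3 * M) := by
              rw [hd]
              gcongr
              exact (norm_sub_le _ _).trans (by gcongr)
          _ = _ := by field_simp; ring
      refine (norm_sub_le _ _).trans ?_
      have e5 := norm_add_le (F s) (s * F1)
      have e6 := hFM t
      linarith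
    · gcongr
      exact le_max_right _ _
end
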